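/- arXiv:2011.00083 — 6 statements merged into one kernel-verified Lean document; each statement's English description precedes it below -/
import Mathlib

section
/- (Theorem 2, upper bound.) There is a universal constant C > 0 such that for every α ∈ (0,1), ℓ ≥ 1, and 1 ≤ s ≤ k/100, there is a public-coin simultaneous–message-passing protocol in which each of the n users sends an ℓ-bit message, such that whenever n ≥ C·s² max{log(k/s), 1}/(α² min{2^ℓ, s}), for every p ∈ Δ_{k,s} the server's output p̂ satisfies Pr(d_TV(p̂, p) ≤ α) ≥ 0.9. -/
open Real BigOperators Finset
open scoped Classical

noncomputable section

/-- A probability vector on `Fin k`. -/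
def probVec {k : ℕ} (p : Fin k → ℝ) : Prop := (∀ x, 0 ≤ p x) ∧ ∑ x, p x = 1

/-- Support size of a vector. -/
def suppSize {k : ℕ} (p : Fin k → ℝ) : ℕ := (Finset.univ.filter fun x => p x ≠ 0).card

/-- Total variation distance. -/
def dTV {k : ℕ} (p q : Fin k → ℝ) : ℝ := (∑ x, |p x - q x|) / 2

/-- Expectation of a product of functions of independent, identically distributed coordinates. -/
lemma sum_prod_weight_mul_prod {T : Type*} [Fintype T] (n : ℕ) (w g : T → ℝ) :
    ∑ ω : Fin n → T, (∏ i, w (ω i)) * ∏ i, g (ω i) = (∑ t, w t * g t) ^ n := by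
  have h := Finset.prod_univ_sum (fun _ : Fin n => (Finset.univ : Finset T))
    (fun _ t => w t * g t)
  simp only [Finset.prod_const, Finset.card_univ, Fintype.card_fin, Fintype.piFinset_univ] at h
  rw [h]
  exact Finset.sum_congr rfl fun ω _ => Finset.prod_mul_distrib.symm

lemma sum_prod_weight {T : Type*} [Fintype T] (n : ℕ) (w : T → ℝ) (hw : ∑ t, w t = 1) :
    ∑ ω : Fin n → T, ∏ i, w (ω i) = 1 := by
  simpa [hw] using sum_prod_weight_mul_prod n w (fun _ => 1)

/-- Moment generating function of a centred Bernoulli variable. -/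
lemma bernoulli_mgf_le {T : Type*} [Fintype T] (w b : T → ℝ) (hw : ∑ t, w t = 1)
    (hb : ∀ t, b t = 0 ∨ b t = 1) (q c : ℝ) (hq : ∑ t, w t * b t = q) (hq0 : 0 ≤ q)
    (hc : |c| ≤ 1) :
    ∑ t, w t * exp (c * (b t - q)) ≤ exp (c ^ 2 * q) := by
  have hpt : ∀ t, w t * exp (c * (b t - q))
      = exp (-(c * q)) * (w t + (w t * b t) * (exp c - 1)) := by
    intro t
    rcases hb t with h | h <;> rw [h]
    · rw [show c * (0 - q) = -(c * q) by ring]; ring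
    · rw [show c * (1 - q) = -(c * q) + c by ring, exp_add]; ring
  simp_rw [hpt]
  rw [← Finset.mul_sum, Finset.sum_add_distrib, ← Finset.sum_mul, hw, hq]
  have h1 : 1 + q * (exp c - 1) ≤ exp (q * (exp c - 1)) := by
    linarith [add_one_le_exp (q * (exp c - 1))]
  have h2 : exp c - 1 - c ≤ c ^ 2 := (le_abs_self _).trans (abs_exp_sub_one_sub_id_le hc)
  calc exp (-(c * q)) * (1 + q * (exp c - 1))
      ≤ exp (-(c * q)) * exp (q * (exp c - 1)) := by gcongr
    _ = exp (q * (exp c - 1 - c)) := by rw [← exp_add]; ring_nf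
    _ ≤ exp (c ^ 2 * q) := by
        rw [mul_comm (c ^ 2)]; gcongr

lemma sample_mean_mgf_le {T : Type*} [Fintype T] (n : ℕ) (hn : 0 < n) (w b : T → ℝ)
    (hw0 : ∀ t, 0 ≤ w t) (hw : ∑ t, w t = 1)
    (hb : ∀ t, b t = 0 ∨ b t = 1) (q a : ℝ) (hq : ∑ t, w t * b t = q) (hq0 : 0 ≤ q)
    (ha : |a| ≤ n) :
    ∑ ω : Fin n → T, (∏ i, w (ω i)) * exp (a * ((∑ i, b (ω i)) / n - q))
      ≤ exp (a ^ 2 * q / n) := by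
  have hn' : (0 : ℝ) < n := by exact_mod_cast hn
  have hpt : ∀ ω : Fin n → T, exp (a * ((∑ i, b (ω i)) / n - q))
      = ∏ i, exp (a / n * (b (ω i) - q)) := by
    intro ω
    rw [← exp_sum, ← Finset.mul_sum, Finset.sum_sub_distrib]
    congr 1
    simp
    field_simp
  simp_rw [hpt]
  rw [sum_prod_weight_mul_prod n w (fun t => exp (a / n * (b t - q)))]
  have hc : |a / n| ≤ 1 := by
    rw [abs_div, abs_of_pos hn', div_le_one hn']; exact ha
  calc (∑ t, w t * exp (a / n * (b t - q))) ^ n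
      ≤ (exp ((a / n) ^ 2 * q)) ^ n := by
        gcongr
        · exact Finset.sum_nonneg fun t _ => mul_nonneg (hw0 t) (exp_pos _).le
        · exact bernoulli_mgf_le w b hw hb q _ hq hq0 hc
    _ = exp (a ^ 2 * q / n) := by
        rw [← exp_nat_mul]
        congr 1
        field_simp

lemma sq_sub_sq_le_exp {a τ d : ℝ} (ha : 0 < a) (hτ : 0 ≤ τ) (hd : τ ≤ d) :
    d ^ 2 - τ ^ 2 ≤ (2 / a ^ 2 + 2 * τ / a) * exp (a * d - a * τ) := by
  have hv : 0 ≤ a * d - a * τ := by nlinarith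
  have h := quadratic_le_exp_of_nonneg hv
  have hE : d ^ 2 - τ ^ 2 = 2 / a ^ 2 * ((a * d - a * τ) ^ 2 / 2)
      + 2 * τ / a * (a * d - a * τ) := by
    field_simp; ring
  rw [hE, add_mul]
  have : 0 ≤ (a * d - a * τ) ^ 2 := sq_nonneg _
  gcongr <;> linarith

/-- An exponential majorant of the truncated square. -/
lemma max_sq_sub_sq_le {a τ : ℝ} (ha : 0 < a) (hτ : 0 ≤ τ) (d : ℝ) :
    max (d ^ 2 - τ ^ 2) 0
      ≤ (2 / a ^ 2 + 2 * τ / a) * exp (-(a * τ)) * (exp (a * d) + exp (-a * d)) := by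
  have hsplit : (2 / a ^ 2 + 2 * τ / a) * exp (-(a * τ)) * (exp (a * d) + exp (-a * d))
      = (2 / a ^ 2 + 2 * τ / a) * exp (a * d - a * τ)
        + (2 / a ^ 2 + 2 * τ / a) * exp (a * (-d) - a * τ) := by
    rw [sub_eq_add_neg, sub_eq_add_neg, exp_add, exp_add,
      show a * -d = -a * d by ring]
    ring
  rw [hsplit]
  have h1 : 0 ≤ (2 / a ^ 2 + 2 * τ / a) * exp (a * d - a * τ) := by positivity
  have h2 : 0 ≤ (2 / a ^ 2 + 2 * τ / a) * exp (a * (-d) - a * τ) := by positivity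
  refine max_le ?_ (by linarith)
  by_cases hd : τ ≤ d
  · linarith [sq_sub_sq_le_exp ha hτ hd]
  by_cases hd' : τ ≤ -d
  · have := sq_sub_sq_le_exp ha hτ hd'
    rw [neg_sq] at this
    linarith
  · have : d ^ 2 ≤ τ ^ 2 := sq_le_sq' (by linarith) (by linarith)
    linarith

/-- Expected excess of the squared deviation of a Bernoulli sample mean over `τ ^ 2`. -/
lemma truncated_deviation_le {T : Type*} [Fintype T] (n : ℕ) (hn : 0 < n) (w b : T → ℝ)
    (hw0 : ∀ t, 0 ≤ w t) (hw : ∑ t, w t = 1)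
    (hb : ∀ t, b t = 0 ∨ b t = 1) (q a τ : ℝ) (hq : ∑ t, w t * b t = q) (hq0 : 0 ≤ q)
    (ha0 : 0 < a) (ha : a ≤ n) (hτ : 0 ≤ τ) :
    ∑ ω : Fin n → T, (∏ i, w (ω i)) * max (((∑ i, b (ω i)) / n - q) ^ 2 - τ ^ 2) 0
      ≤ 2 * (2 / a ^ 2 + 2 * τ / a) * exp (a ^ 2 * q / n - a * τ) := by
  have hp := sample_mean_mgf_le n hn w b hw0 hw hb q a hq hq0 (by rwa [abs_of_pos ha0])
  have hm := sample_mean_mgf_le n hn w b hw0 hw hb q (-a) hq hq0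
    (by rwa [abs_neg, abs_of_pos ha0])
  rw [neg_sq] at hm
  calc ∑ ω : Fin n → T, (∏ i, w (ω i)) * max (((∑ i, b (ω i)) / n - q) ^ 2 - τ ^ 2) 0
      ≤ ∑ ω : Fin n → T, (∏ i, w (ω i)) * ((2 / a ^ 2 + 2 * τ / a) * exp (-(a * τ)) *
          (exp (a * ((∑ i, b (ω i)) / n - q)) + exp (-a * ((∑ i, b (ω i)) / n - q)))) := by
        refine Finset.sum_le_sum fun ω _ => mul_le_mul_of_nonneg_left
          (max_sq_sub_sq_le ha0 hτ _) (Finset.prod_nonneg fun i _ => hw0 _)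
    _ = (2 / a ^ 2 + 2 * τ / a) * exp (-(a * τ)) *
          (∑ ω : Fin n → T, (∏ i, w (ω i)) * exp (a * ((∑ i, b (ω i)) / n - q))
          + ∑ ω : Fin n → T, (∏ i, w (ω i)) * exp (-a * ((∑ i, b (ω i)) / n - q))) := by
        rw [← Finset.sum_add_distrib, Finset.mul_sum]
        exact Finset.sum_congr rfl fun ω _ => by ring
    _ ≤ (2 / a ^ 2 + 2 * τ / a) * exp (-(a * τ)) *
          (exp (a ^ 2 * q / n) + exp (a ^ 2 * q / n)) := by gcongr
    _ = 2 * (2 / a ^ 2 + 2 * τ / a) * exp (a ^ 2 * q / n - a * τ) := by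
        rw [sub_eq_add_neg, exp_add]; ring

/-- Two distinct points collide under a uniformly random hash with probability `1 / B`. -/
lemma hash_collision {k B : ℕ} (hB : 0 < B) (x z : Fin k) (hxz : x ≠ z) :
    ∑ h : Fin k → Fin B, ((1 : ℝ) / B) ^ k * (if h x = h z then 1 else 0) = 1 / B := by
  have hB' : (B : ℝ) ≠ 0 := by positivity
  have hpt : ∀ h : Fin k → Fin B, ((1 : ℝ) / B) ^ k * (if h x = h z then 1 else 0)
      = ∑ c : Fin B, ∏ m, ((1 : ℝ) / B *
          (if m = x ∨ m = z then (if h m = c then 1 else 0) else 1)) := by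
    intro h
    simp_rw [Finset.prod_mul_distrib, Finset.prod_const, Finset.card_univ, Fintype.card_fin]
    rw [← Finset.mul_sum]
    congr 1
    have : ∀ c : Fin B, (∏ m, if m = x ∨ m = z then (if h m = c then (1 : ℝ) else 0) else 1)
        = if h x = c then (if h z = c then 1 else 0) else 0 := by
      intro c
      rw [Finset.prod_ite, Finset.prod_const_one, mul_one,
        show Finset.univ.filter (fun m => m = x ∨ m = z) = {x, z} by ext; simp,
        Finset.prod_pair hxz]
      split_ifs <;> simp
    simp_rw [this]
    simp [eq_comm]
  simp_rw [hpt]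
  rw [Finset.sum_comm]
  have hc : ∀ c : Fin B, ∑ h : Fin k → Fin B, ∏ m, ((1 : ℝ) / B *
          (if m = x ∨ m = z then (if h m = c then 1 else 0) else 1)) = (1 / B) ^ 2 := by
    intro c
    have h := Finset.prod_univ_sum (fun _ : Fin k => (Finset.univ : Finset (Fin B)))
      (fun m t => (1 : ℝ) / B * (if m = x ∨ m = z then (if t = c then 1 else 0) else 1))
    rw [Fintype.piFinset_univ] at h
    rw [← h]
    have hm : ∀ m : Fin k, ∑ t : Fin B,
        (1 : ℝ) / B * (if m = x ∨ m = z then (if t = c then 1 else 0) else 1)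
        = if m = x ∨ m = z then (1 : ℝ) / B else 1 := by
      intro m
      split_ifs
      · simp
      · simp [hB']
    simp_rw [hm]
    rw [Finset.prod_ite, Finset.prod_const_one, mul_one, Finset.prod_const,
      show Finset.univ.filter (fun m => m = x ∨ m = z) = {x, z} by ext; simp,
      Finset.card_pair hxz]
  simp_rw [hc]
  simp
  field_simp

lemma hash_weight_sum {k B : ℕ} (hB : 0 < B) :
    ∑ _h : Fin k → Fin B, ((1 : ℝ) / B) ^ k = 1 := by
  have hB' : (B : ℝ) ≠ 0 := by positivity
  simp [hB']

/-- Joint weight of a uniformly random hash function and a sample from `p`. -/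
def hashWeight {k : ℕ} (B : ℕ) (p : Fin k → ℝ) (t : (Fin k → Fin B) × Fin k) : ℝ :=
  ((1 : ℝ) / B) ^ k * p t.2

/-- Indicator that the hash of the sample agrees with the hash of `z`. -/
def hashHit {k B : ℕ} (z : Fin k) (t : (Fin k → Fin B) × Fin k) : ℝ :=
  if t.1 t.2 = t.1 z then 1 else 0

lemma hashWeight_nonneg {k B : ℕ} {p : Fin k → ℝ} (hp : probVec p)
    (t : (Fin k → Fin B) × Fin k) : 0 ≤ hashWeight B p t := by
  have := hp.1 t.2
  unfold hashWeight
  positivity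

lemma sum_hashWeight {k B : ℕ} (hB : 0 < B) {p : Fin k → ℝ} (hp : probVec p) :
    ∑ t, hashWeight B p t = 1 := by
  rw [Fintype.sum_prod_type]
  refine Eq.trans (Finset.sum_congr rfl fun h _ => ?_) (hash_weight_sum hB)
  simp only [hashWeight]
  rw [← Finset.mul_sum, hp.2, mul_one]

lemma sum_hashWeight_mul_hashHit {k B : ℕ} (hB : 0 < B) {p : Fin k → ℝ} (hp : probVec p)
    (z : Fin k) :
    ∑ t, hashWeight B p t * hashHit z t = 1 / B + p z * (1 - 1 / B) := by
  rw [Fintype.sum_prod_type, Finset.sum_comm]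
  have hx : ∀ x : Fin k, ∑ h : Fin k → Fin B, hashWeight B p (h, x) * hashHit z (h, x)
      = p x * (1 / B) + if x = z then p x * (1 - 1 / B) else 0 := by
    intro x
    have : ∀ h : Fin k → Fin B, hashWeight B p (h, x) * hashHit z (h, x)
        = p x * (((1 : ℝ) / B) ^ k * (if h x = h z then 1 else 0)) := by
      intro h; simp only [hashWeight, hashHit]; ring
    simp_rw [this]
    rw [← Finset.mul_sum]
    split_ifs with hxz
    · subst hxz
      simp only [if_true, mul_one]
      rw [hash_weight_sum hB]; ring
    · rw [hash_collision hB x z hxz, add_zero]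
  simp_rw [hx]
  rw [Finset.sum_add_distrib, ← Finset.sum_mul, hp.2]
  simp

/-- Averaging over the public hashes and the messages is averaging over hash-sample pairs. -/
lemma protocol_expectation {k B n : ℕ} {Y : Type*} [Fintype Y] [DecidableEq Y] (e : Fin B → Y)
    (p : Fin k → ℝ) (F : (Fin n → Fin k → Fin B) → (Fin n → Y) → ℝ) :
    ∑ h : Fin n → Fin k → Fin B, (((1 : ℝ) / B) ^ k) ^ n *
        ∑ y : Fin n → Y, (∏ i, ∑ x, p x * (if y i = e (h i x) then 1 else 0)) * F h y
      = ∑ ω : Fin n → (Fin k → Fin B) × Fin k, (∏ i, hashWeight B p (ω i)) *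
          F (fun i => (ω i).1) (fun i => e ((ω i).1 (ω i).2)) := by
  rw [← (Equiv.arrowProdEquivProdArrow (Fin n) (fun _ => Fin k → Fin B)
    (fun _ => Fin k)).symm.sum_comp, Fintype.sum_prod_type]
  refine Finset.sum_congr rfl fun h _ => ?_
  have hy : ∀ y : Fin n → Y, (∏ i, ∑ x, p x * (if y i = e (h i x) then (1 : ℝ) else 0))
      = ∑ X : Fin n → Fin k, (∏ i, p (X i)) *
          (if y = fun i => e (h i (X i)) then 1 else 0) := by
    intro y
    have hp := Finset.prod_univ_sum (fun _ : Fin n => (Finset.univ : Finset (Fin k)))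
      (fun i x => p x * (if y i = e (h i x) then (1 : ℝ) else 0))
    rw [Fintype.piFinset_univ] at hp
    rw [hp]
    refine Finset.sum_congr rfl fun X _ => ?_
    rw [Finset.prod_mul_distrib, Finset.prod_boole]
    simp [funext_iff]
  simp_rw [hy, Finset.sum_mul]
  rw [Finset.sum_comm, Finset.mul_sum]
  refine Finset.sum_congr rfl fun X _ => ?_
  simp [hashWeight, Equiv.arrowProdEquivProdArrow, Finset.prod_mul_distrib, mul_assoc]

/-- Empirical frequency with which the messages agree with the hashes of `z`. -/
def hitRate {k B n : ℕ} {Y : Type*} [DecidableEq Y] (e : Fin B → Y) (h : Fin n → Fin k → Fin B)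
    (y : Fin n → Y) (z : Fin k) : ℝ :=
  (∑ i, if y i = e (h i z) then (1 : ℝ) else 0) / n

/-- The hit rates `r` are close to those expected under `q` on every set of at most `2 * s`
coordinates. -/
def hitRatesFit {k : ℕ} (B s : ℕ) (β : ℝ) (r q : Fin k → ℝ) : Prop :=
  ∀ A : Finset (Fin k), A.card ≤ 2 * s →
    ∑ z ∈ A, (r z - (1 / B + q z * (1 - 1 / B))) ^ 2 ≤ β

/-- Sparse vectors that fit the same hit rates are close in total variation. -/
lemma dTV_le_of_hitRatesFit {k B s : ℕ} (hB : 2 ≤ B) {β α : ℝ} (hα : 0 ≤ α)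
    {r p q : Fin k → ℝ} (hp : suppSize p ≤ s) (hq : suppSize q ≤ s)
    (hrp : hitRatesFit B s β r p) (hrq : hitRatesFit B s β r q) (hβ : 8 * s * β ≤ α ^ 2) :
    dTV q p ≤ α := by
  set A : Finset (Fin k) :=
    (Finset.univ.filter fun x => p x ≠ 0) ∪ (Finset.univ.filter fun x => q x ≠ 0) with hA
  have hcard : A.card ≤ 2 * s := by
    refine (Finset.card_union_le _ _).trans ?_
    unfold suppSize at hp hq
    omega
  have hB' : (2 : ℝ) ≤ B := by exact_mod_cast hB
  have hinv : (1 : ℝ) / B ≤ 1 / 2 := by gcongr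
  have hsq : ∑ z ∈ A, (q z - p z) ^ 2 ≤ 16 * β := by
    have hpt : ∀ z ∈ A, (q z - p z) ^ 2 ≤ 8 * ((r z - (1 / B + p z * (1 - 1 / B))) ^ 2
        + (r z - (1 / B + q z * (1 - 1 / B))) ^ 2) := by
      intro z _
      have h1 : (1 / 4 : ℝ) ≤ (1 - 1 / B) ^ 2 := by nlinarith
      have h2 := sq_nonneg ((r z - (1 / B + p z * (1 - 1 / B)))
        + (r z - (1 / B + q z * (1 - 1 / B))))
      have h3 := mul_le_mul_of_nonneg_right h1 (sq_nonneg (q z - p z))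
      nlinarith
    calc _ ≤ _ := Finset.sum_le_sum hpt
      _ ≤ 16 * β := by
        rw [← Finset.mul_sum, Finset.sum_add_distrib]
        linarith [hrp A hcard, hrq A hcard]
  have hsum : ∑ x, |q x - p x| = ∑ x ∈ A, |q x - p x| := by
    symm
    refine Finset.sum_subset (Finset.subset_univ _) fun x _ hx => ?_
    simp [hA] at hx
    simp [hx.1, hx.2]
  have hcs : (∑ x ∈ A, |q x - p x|) ^ 2 ≤ A.card * ∑ x ∈ A, (q x - p x) ^ 2 := by
    simpa using sq_sum_le_card_mul_sum_sq (s := A) (f := fun x => |q x - p x|)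
  have hcard' : (A.card : ℝ) ≤ 2 * s := by exact_mod_cast hcard
  have hnn : 0 ≤ ∑ z ∈ A, (q z - p z) ^ 2 := Finset.sum_nonneg fun _ _ => sq_nonneg _
  have hb : (∑ x ∈ A, |q x - p x|) ^ 2 ≤ 2 * s * (16 * β) :=
    hcs.trans (mul_le_mul hcard' hsq hnn (by positivity))
  unfold dTV
  rw [hsum]
  refine abs_le_of_sq_le_sq' ?_ hα |>.2
  rw [div_pow]
  linarith

/-- The true distribution fits the observed hit rates with probability at least `9 / 10`. -/
lemma hitRatesFit_prob {k s B n : ℕ} (hn : 0 < n) (hs : 1 ≤ s) (hB : 2 ≤ B)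
    (hBs : B ≤ 2 * s) {L : ℝ} (hL : 1 ≤ L) (hkL : k * exp (-L) ≤ s) (hnL : B * L ≤ n)
    {p : Fin k → ℝ} (hp : probVec p) (hps : suppSize p ≤ s) :
    (9 : ℝ) / 10 ≤ ∑ ω : Fin n → (Fin k → Fin B) × Fin k, (∏ i, hashWeight B p (ω i)) *
      (if hitRatesFit B s (458 * (s * L / (n * B)))
        (fun z => (∑ i, hashHit z (ω i)) / n) p then 1 else 0) := by
  have hn' : (0 : ℝ) < n := by exact_mod_cast hn
  have hs' : (1 : ℝ) ≤ s := by exact_mod_cast hs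
  have hB' : (2 : ℝ) ≤ B := by exact_mod_cast hB
  have hBs' : (B : ℝ) ≤ 2 * s := by exact_mod_cast hBs
  have hB0 : (0 : ℝ) < B := by linarith
  have hL0 : 0 < L := by linarith
  have hinv : (1 : ℝ) / B ≤ 1 / 2 := by gcongr
  have hinv0 : (0 : ℝ) < 1 / B := by positivity
  have hBn : 1 ≤ B := by omega
  set m : Fin k → ℝ := fun z => 1 / B + p z * (1 - 1 / B) with hm
  have hmB : ∀ z, 1 / (B : ℝ) ≤ m z := fun z => by
    have := mul_nonneg (hp.1 z) (show (0 : ℝ) ≤ 1 - 1 / B by linarith)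
    simp only [hm]; linarith
  have hmle : ∀ z, m z ≤ p z + 1 / B := fun z => by
    have := mul_nonneg (hp.1 z) hinv0.le
    simp only [hm]; linarith
  set w := hashWeight B p with hwdef
  have hw0 : ∀ t, 0 ≤ w t := hashWeight_nonneg hp
  have hw1 : ∑ t, w t = 1 := sum_hashWeight hBn hp
  have hhit : ∀ (z : Fin k) (t : (Fin k → Fin B) × Fin k), hashHit z t = 0 ∨ hashHit z t = 1 := by
    intro z t; unfold hashHit; split_ifs <;> simp
  set κ : ℝ := s / (n * B) with hκ
  have hκ0 : 0 < κ := by positivity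
  set τ : ℝ := 2 * sqrt (L / (n * B)) with hτ
  have hτsq : τ ^ 2 = 4 * (L / (n * B)) := by
    rw [hτ, mul_pow, sq_sqrt (by positivity)]; ring
  set θ : Fin k → ℝ := fun z => if p z ≠ 0 then 0 else τ with hθ
  have hθsq : ∀ z, θ z ^ 2 ≤ τ ^ 2 := by
    intro z; simp only [hθ]; split_ifs
    · simpa using sq_nonneg τ
    · exact le_rfl
  set D : Fin k → (Fin n → (Fin k → Fin B) × Fin k) → ℝ :=
    fun z ω => (∑ i, hashHit z (ω i)) / n - m z with hD
  set R : (Fin n → (Fin k → Fin B) × Fin k) → ℝ :=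
    fun ω => ∑ z, max (D z ω ^ 2 - θ z ^ 2) 0 with hR
  have hR0 : ∀ ω, 0 ≤ R ω := fun ω => Finset.sum_nonneg fun z _ => le_max_right _ _
  -- coordinates in the support
  have hin : ∀ z, p z ≠ 0 → ∑ ω : Fin n → (Fin k → Fin B) × Fin k,
      (∏ i, w (ω i)) * max (D z ω ^ 2 - θ z ^ 2) 0 ≤ 11 / n * (p z + 1 / B) := by
    intro z hz
    have hmz : 0 < m z := hinv0.trans_le (hmB z)
    have ha0 : 0 < sqrt (n / m z) := sqrt_pos.2 (by positivity)
    have hasq : sqrt (n / m z) ^ 2 = n / m z := sq_sqrt (by positivity)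
    have ha : sqrt (n / m z) ≤ n := by
      rw [sqrt_le_left hn'.le, div_le_iff₀ hmz]
      have h1 : (1 : ℝ) ≤ n * m z := by
        calc (1 : ℝ) = B * (1 / B) := by field_simp
          _ ≤ n * m z := by
            gcongr
            · exact_mod_cast (le_mul_of_one_le_right hB0.le hL).trans hnL
            · exact hmB z
      nlinarith
    have h := truncated_deviation_le n hn w (hashHit z) hw0 hw1 (hhit z) (m z) _ 0
      (sum_hashWeight_mul_hashHit hBn hp z) hmz.le ha0 ha le_rfl
    rw [hasq] at h
    have hθz : θ z = 0 := by simp [hθ, hz]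
    rw [hθz]
    refine h.trans ?_
    have he : (n : ℝ) / m z * m z / n - sqrt (n / m z) * 0 = 1 := by field_simp; simp
    rw [he]
    have he1 : exp 1 ≤ 11 / 4 := by linarith [exp_one_lt_d9]
    calc 2 * (2 / (n / m z) + 2 * 0 / sqrt (n / m z)) * exp 1
        = 4 * (m z / n) * exp 1 := by field_simp; ring
      _ ≤ 4 * (m z / n) * (11 / 4) := by gcongr
      _ = 11 / n * m z := by ring
      _ ≤ 11 / n * (p z + 1 / B) := by gcongr; exact hmle z
  -- coordinates outside the support
  have hout : ∀ z, p z = 0 → ∑ ω : Fin n → (Fin k → Fin B) × Fin k,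
      (∏ i, w (ω i)) * max (D z ω ^ 2 - θ z ^ 2) 0 ≤ 12 / (n * B) * exp (-L) := by
    intro z hz
    have hmz : m z = 1 / B := by simp [hm, hz]
    have hθz : θ z = τ := by simp [hθ, hz]
    have ha0 : 0 < sqrt (n * B * L) := sqrt_pos.2 (by positivity)
    have hasq : sqrt (n * B * L) ^ 2 = n * B * L := sq_sqrt (by positivity)
    have ha : sqrt (n * B * L) ≤ n := by
      rw [sqrt_le_left hn'.le]; nlinarith
    have hτa : τ = 2 * sqrt (n * B * L) / (n * B) := by
      have : L / (n * B) = (n * B * L) / (n * B) ^ 2 := by field_simp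
      rw [hτ, this, sqrt_div' _ (by positivity), sqrt_sq (by positivity)]; ring
    have h := truncated_deviation_le n hn w (hashHit z) hw0 hw1 (hhit z) (m z) _ τ
      (sum_hashWeight_mul_hashHit hBn hp z) (by rw [hmz]; positivity) ha0 ha (by positivity)
    rw [hθz]
    refine h.trans ?_
    have he : sqrt (n * B * L) ^ 2 * m z / n - sqrt (n * B * L) * τ = -L := by
      rw [hτa, hmz]
      have : sqrt (n * B * L) * (2 * sqrt (n * B * L) / (n * B))
          = 2 * sqrt (n * B * L) ^ 2 / (n * B) := by ring
      rw [this, hasq]; field_simp; ring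
    rw [he]
    gcongr
    have h1 : 2 * τ / sqrt (n * B * L) = 4 / (n * B) := by
      rw [hτa]; field_simp; ring
    rw [h1, hasq]
    have h2 : 2 / (n * B * L) ≤ 2 / (n * B : ℝ) := by
      exact div_le_div_of_nonneg_left (by norm_num) (by positivity)
        (le_mul_of_one_le_right (by positivity) hL)
    calc 2 * (2 / (n * B * L) + 4 / (n * B : ℝ)) ≤ 2 * (2 / (n * B) + 4 / (n * B)) := by gcongr
      _ = 12 / (n * B) := by ring
  have hER : ∑ ω : Fin n → (Fin k → Fin B) × Fin k, (∏ i, w (ω i)) * R ω ≤ 45 * κ := by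
    simp only [hR, Finset.mul_sum]
    rw [Finset.sum_comm]
    have hz : ∀ z, ∑ ω : Fin n → (Fin k → Fin B) × Fin k,
        (∏ i, w (ω i)) * max (D z ω ^ 2 - θ z ^ 2) 0
        ≤ 11 / n * (p z + if p z ≠ 0 then (1 : ℝ) / B else 0) + 12 / (n * B) * exp (-L) := by
      intro z
      by_cases hz : p z = 0
      · simpa [hz] using hout z hz
      · have := hin z hz
        rw [if_pos hz]
        have : 0 ≤ 12 / (n * B) * exp (-L) := by positivity
        linarith
    refine (Finset.sum_le_sum fun z _ => hz z).trans ?_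
    rw [Finset.sum_add_distrib, ← Finset.mul_sum, Finset.sum_add_distrib, hp.2,
      ← Finset.sum_filter, Finset.sum_const, Finset.sum_const, Finset.card_univ,
      Fintype.card_fin, nsmul_eq_mul, nsmul_eq_mul]
    have hps' : ((Finset.univ.filter fun x => p x ≠ 0).card : ℝ) ≤ s := by
      exact_mod_cast hps
    have h1 : 11 / (n : ℝ) * (1 + ((Finset.univ.filter fun x => p x ≠ 0).card : ℝ) * (1 / B))
        ≤ 33 * κ := by
      calc _ ≤ 11 / (n : ℝ) * (2 * s / B + s * (1 / B)) := by
            gcongr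
            rwa [one_le_div hB0]
        _ = 33 * κ := by rw [hκ]; field_simp; ring
    have h2 : (k : ℝ) * (12 / (n * B) * exp (-L)) ≤ 12 * κ := by
      calc (k : ℝ) * (12 / (n * B) * exp (-L)) = 12 / (n * B) * (k * exp (-L)) := by ring
        _ ≤ 12 / (n * B) * s := by gcongr
        _ = 12 * κ := by rw [hκ]; ring
    linarith
  have hpt : ∀ ω : Fin n → (Fin k → Fin B) × Fin k, 1 - R ω / (450 * κ) ≤
      if hitRatesFit B s (458 * (s * L / (n * B)))
        (fun z => (∑ i, hashHit z (ω i)) / n) p then 1 else 0 := by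
    intro ω
    split_ifs with hfit
    · have := div_nonneg (hR0 ω) (show 0 ≤ 450 * κ by positivity)
      linarith
    · rw [sub_nonpos, one_le_div (by positivity)]
      by_contra! hlt
      refine hfit fun A hA => ?_
      have hA' : (A.card : ℝ) ≤ 2 * s := by exact_mod_cast hA
      calc ∑ z ∈ A, D z ω ^ 2
          ≤ ∑ z ∈ A, (max (D z ω ^ 2 - θ z ^ 2) 0 + τ ^ 2) :=
            Finset.sum_le_sum fun z _ => by
              linarith [le_max_left (D z ω ^ 2 - θ z ^ 2) 0, hθsq z]
        _ ≤ R ω + 2 * s * τ ^ 2 := by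
            rw [Finset.sum_add_distrib, Finset.sum_const, nsmul_eq_mul]
            gcongr
            exact Finset.sum_le_univ_sum_of_nonneg fun z => le_max_right _ _
        _ ≤ 450 * κ + 2 * s * τ ^ 2 := by linarith
        _ = 450 * κ + 8 * (κ * L) := by rw [hτsq, hκ]; ring
        _ ≤ 458 * (κ * L) := by nlinarith
        _ = 458 * (s * L / (n * B)) := by rw [hκ]; ring
  calc (9 : ℝ) / 10 ≤ 1 - (∑ ω : Fin n → (Fin k → Fin B) × Fin k, (∏ i, w (ω i)) * R ω)
        / (450 * κ) := by
        have : (∑ ω : Fin n → (Fin k → Fin B) × Fin k, (∏ i, w (ω i)) * R ω)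
          / (450 * κ) ≤ 1 / 10 := by
          rw [div_le_iff₀ (by positivity)]; linarith
        linarith
    _ = ∑ ω : Fin n → (Fin k → Fin B) × Fin k, (∏ i, w (ω i)) * (1 - R ω / (450 * κ)) := by
        simp_rw [mul_sub, mul_one]
        rw [Finset.sum_sub_distrib, sum_prod_weight n w hw1, Finset.sum_div]
        simp_rw [mul_div_assoc]
    _ ≤ _ := Finset.sum_le_sum fun ω _ =>
        mul_le_mul_of_nonneg_left (hpt ω) (Finset.prod_nonneg fun i _ => hw0 _)

/-- Theorem 2, upper bound: there is a universal constant `C > 0` such that for every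
`α ∈ (0,1)`, `ℓ ≥ 1`, and `1 ≤ s ≤ k/100`, there is a public-coin SMP protocol (public
randomness `u` with distribution `μ` on a finite set, channels `W u i` from `[k]` to
`{0,1}^ℓ`, estimator `est`) such that whenever `n ≥ C s² max{log(k/s),1}/(α² min{2^ℓ,s})`,
for every `p ∈ Δ_{k,s}` the output satisfies `d_TV(p̂,p) ≤ α` with probability ≥ 0.9. -/
theorem thm2_comm_upper :
    ∃ C : ℝ, 0 < C ∧
      ∀ (k s l n : ℕ) (α : ℝ),
        0 < α → α < 1 → 1 ≤ l → 1 ≤ s → 100 * s ≤ k →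
        C * (s : ℝ) ^ 2 * max (Real.log ((k : ℝ) / (s : ℝ))) 1 /
            (α ^ 2 * min ((2 : ℝ) ^ l) (s : ℝ)) ≤ (n : ℝ) →
        ∃ (M : ℕ) (μ : Fin M → ℝ)
          (W : Fin M → Fin n → Fin k → (Fin l → Bool) → ℝ)
          (est : Fin M → (Fin n → Fin l → Bool) → Fin k → ℝ),
          (∀ u, 0 ≤ μ u) ∧ (∑ u, μ u = 1) ∧
          (∀ u i x, (∀ y, 0 ≤ W u i x y) ∧ ∑ y, W u i x y = 1) ∧
          ∀ p : Fin k → ℝ, probVec p → suppSize p ≤ s →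
            (9 : ℝ) / 10 ≤
              ∑ u, μ u *
                ∑ y : Fin n → Fin l → Bool,
                  (∏ i, ∑ x, p x * W u i x (y i)) * (if dTV (est u y) p ≤ α then 1 else 0) := by
  refine ⟨4000, by norm_num, ?_⟩
  intro k s l n α hα hα1 hl hs hks hn
  set L : ℝ := max (Real.log ((k : ℝ) / (s : ℝ))) 1 with hLdef
  have hL : 1 ≤ L := le_max_right _ _
  have hs' : (1 : ℝ) ≤ s := by exact_mod_cast hs
  have hk : 0 < k := by omega
  have hk' : (0 : ℝ) < k := by exact_mod_cast hk
  set b : ℝ := min ((2 : ℝ) ^ l) (s : ℝ) with hb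
  have hb0 : 0 < b := lt_min (by positivity) (by linarith)
  have hbs : b ≤ s := min_le_right _ _
  obtain ⟨B, hB⟩ : ∃ B, B = min (2 ^ l) (2 * s) := ⟨_, rfl⟩
  have hB2 : 2 ≤ B := by
    have := Nat.pow_le_pow_right (show 0 < 2 by norm_num) hl
    rw [hB, le_min_iff]; constructor <;> omega
  have hB0 : (0 : ℝ) < B := Nat.cast_pos.2 (by omega)
  have hBs : B ≤ 2 * s := hB ▸ min_le_right _ _
  have hBs' : (B : ℝ) ≤ 2 * s := by exact_mod_cast hBs
  have hbB : b ≤ B := by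
    rw [hB]; push_cast
    exact min_le_min le_rfl (by linarith)
  have hnb : 4000 * (s : ℝ) ^ 2 * L ≤ n * (α ^ 2 * b) := (div_le_iff₀ (by positivity)).1 hn
  have hα2 : α ^ 2 ≤ 1 := by nlinarith
  have hnL : B * L ≤ n := by
    have h1 : (n : ℝ) * (α ^ 2 * b) ≤ n * (1 * s) := by gcongr
    have h2 : 4000 * (s * L) ≤ (n : ℝ) := by
      refine le_of_mul_le_mul_right ?_ (show (0 : ℝ) < s by linarith)
      linarith
    nlinarith
  have hn0' : (0 : ℝ) < n := lt_of_lt_of_le (by positivity) hnL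
  have hn0 : 0 < n := by exact_mod_cast hn0'
  have hkL : k * exp (-L) ≤ s := by
    have h1 : exp (-L) ≤ s / k := by
      calc exp (-L) ≤ exp (-Real.log ((k : ℝ) / s)) :=
            exp_le_exp.2 (neg_le_neg (le_max_left _ _))
        _ = s / k := by rw [exp_neg, exp_log (by positivity), inv_div]
    calc k * exp (-L) ≤ k * (s / k) := by gcongr
      _ = s := by field_simp
  have hcardle : Fintype.card (Fin B) ≤ Fintype.card (Fin l → Bool) := by
    simp [hB]
  obtain ⟨e⟩ := Function.Embedding.nonempty_of_card_le hcardle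
  set β : ℝ := 458 * (s * L / (n * B)) with hβ
  have hβα : 8 * s * β ≤ α ^ 2 := by
    have : 8 * s * β = 3664 * s ^ 2 * L / (n * B) := by rw [hβ]; ring
    rw [this, div_le_iff₀ (by positivity)]
    have h1 : (n : ℝ) * (α ^ 2 * b) ≤ n * (α ^ 2 * B) := by gcongr
    have h2 : 0 ≤ (s : ℝ) ^ 2 * L := by positivity
    linarith
  set φ := (Fintype.equivFin (Fin n → Fin k → Fin B)).symm with hφ
  set est : (Fin n → Fin k → Fin B) → (Fin n → Fin l → Bool) → Fin k → ℝ := fun h y =>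
    if H : ∃ q : Fin k → ℝ, suppSize q ≤ s ∧ hitRatesFit B s β (hitRate e h y) q
    then H.choose else 0 with hest
  have hμ : ∑ _h : Fin n → Fin k → Fin B, (((1 : ℝ) / B) ^ k) ^ n = 1 := by
    have := sum_prod_weight n (fun _ : Fin k → Fin B => ((1 : ℝ) / B) ^ k)
      (hash_weight_sum (by omega))
    simpa only [Finset.prod_const, Finset.card_univ, Fintype.card_fin] using this
  refine ⟨Fintype.card (Fin n → Fin k → Fin B), fun _ => (((1 : ℝ) / B) ^ k) ^ n,
    fun u i x y => if y = e (φ u i x) then 1 else 0, fun u y => est (φ u) y,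
    fun u => by positivity, ?_, ?_, ?_⟩
  · rw [φ.sum_comp (fun _ => (((1 : ℝ) / B) ^ k) ^ n)]
    exact hμ
  · intro u i x
    refine ⟨fun y => by dsimp only; split_ifs <;> norm_num, by simp⟩
  · intro p hp hps
    rw [φ.sum_comp (fun h => (((1 : ℝ) / B) ^ k) ^ n * ∑ y : Fin n → Fin l → Bool,
      (∏ i, ∑ x, p x * (if y i = e (h i x) then 1 else 0)) *
        (if dTV (est h y) p ≤ α then 1 else 0)),
      protocol_expectation e p (fun h y => if dTV (est h y) p ≤ α then 1 else 0)]
    refine (hitRatesFit_prob hn0 hs hB2 hBs hL hkL hnL hp hps).trans ?_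
    refine Finset.sum_le_sum fun ω _ => mul_le_mul_of_nonneg_left ?_
      (Finset.prod_nonneg fun i _ => hashWeight_nonneg hp _)
    have hrate : (fun z => (∑ i, hashHit z (ω i)) / (n : ℝ))
        = hitRate e (fun i => (ω i).1) (fun i => e ((ω i).1 (ω i).2)) := by
      funext z
      simp [hitRate, hashHit]
    rw [hrate]
    split_ifs with hfit hd hd
    · exact le_rfl
    · refine absurd ?_ hd
      have H : ∃ q : Fin k → ℝ, suppSize q ≤ s ∧ hitRatesFit B s β
          (hitRate e (fun i => (ω i).1) (fun i => e ((ω i).1 (ω i).2))) q := ⟨p, hps, hfit⟩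
      simp only [hest, dif_pos H]
      exact dTV_le_of_hitRatesFit hB2 hα.le hps H.choose_spec.1 hfit H.choose_spec.2 hβα
    · exact zero_le_one
    · exact le_rfl
end
end

section
/- (Lemma 1.) In the 1-bit Hadamard Response with projection scheme run with n users on a distribution p ∈ Δ_{k,s} (with 1 ≤ s ≤ k/100), with probability at least 9/10 the intermediate estimate p̃ and the projected estimate p̂ satisfy ⟨p̃ − p, p̂ − p⟩ ≤ 25·((e^ε+1)/(e^ε−1))·√(s log(2k/s)/n)·‖p̂ − p‖₂. -/
open Real BigOperators Finset
open scoped Classical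

noncomputable section

/-- Entry `(x,y)` of the `K × K` Sylvester Hadamard matrix (`K = 2^m`). -/
def had (K : ℕ) (x y : Fin K) : ℝ := (-1 : ℝ) ^ ((Nat.digits 2 (x.val &&& y.val)).sum)

/-- Group of user `i`: users are split deterministically into `K = 2^m` groups by `i mod K`. -/
def grp {n : ℕ} (m : ℕ) (i : Fin n) : Fin (2 ^ m) :=
  ⟨i.val % 2 ^ m, Nat.mod_lt _ (by positivity)⟩

/-- Probability that user `i` (in group `grp m i`) sends the bit `1` when its sample is
drawn from `p`: it sends `1` w.p. `e^ε/(e^ε+1)` if `X_i ∈ B_{grp i}` and w.p. `1/(e^ε+1)`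
otherwise. -/
def bitProb {k n : ℕ} (m : ℕ) (hk : k ≤ 2 ^ m) (ε : ℝ) (p : Fin k → ℝ) (i : Fin n) : ℝ :=
  ∑ x, p x * (if had (2 ^ m) (Fin.castLE hk x) (grp m i) = 1 then
    Real.exp ε / (Real.exp ε + 1) else 1 / (Real.exp ε + 1))

/-- Joint pmf of the `n` (independent) privatized bits `Y_1,…,Y_n`. -/
def outP {k n : ℕ} (m : ℕ) (hk : k ≤ 2 ^ m) (ε : ℝ) (p : Fin k → ℝ) (y : Fin n → Bool) : ℝ :=
  ∏ i, if y i then bitProb m hk ε p i else 1 - bitProb m hk ε p i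

/-- `t̂_j`: the fraction of messages from group `S_j` that equal `1`. -/
def tHat {n : ℕ} (m : ℕ) (y : Fin n → Bool) (j : Fin (2 ^ m)) : ℝ :=
  ((Finset.univ.filter fun i : Fin n => grp m i = j ∧ y i = true).card : ℝ) /
    ((Finset.univ.filter fun i : Fin n => grp m i = j).card : ℝ)

/-- The intermediate Hadamard-Response estimate: the first `k` coordinates of
`p̃_K = ((e^ε+1)/(K(e^ε−1)))·H_K·(2t̂ − 1_K)`. -/
def pTil {k n : ℕ} (m : ℕ) (hk : k ≤ 2 ^ m) (ε : ℝ) (y : Fin n → Bool) (x : Fin k) : ℝ :=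
  ((Real.exp ε + 1) / (((2 : ℝ) ^ m) * (Real.exp ε - 1))) *
    ∑ j, had (2 ^ m) (Fin.castLE hk x) j * (2 * tHat m y j - 1)

lemma neg_one_pow_digits_sum (a : ℕ) :
    (-1 : ℝ) ^ ((Nat.digits 2 a).sum) =
      (-1 : ℝ) ^ (a % 2) * (-1 : ℝ) ^ ((Nat.digits 2 (a / 2)).sum) := by
  rcases Nat.eq_zero_or_pos a with rfl | ha
  · simp
  · rw [Nat.digits_def' (by norm_num) ha, List.sum_cons, pow_add]

lemma land_bit_zero_parity (a j : ℕ) :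
    (-1 : ℝ) ^ ((Nat.digits 2 (a &&& (2 * j))).sum) =
      (-1 : ℝ) ^ ((Nat.digits 2 (a / 2 &&& j)).sum) := by
  have h : (a &&& (2 * j)) % 2 = 0 := by
    have := (Nat.and_mod_two_eq_one (a := a) (b := 2 * j)).not.2 (by omega)
    omega
  rw [neg_one_pow_digits_sum, Nat.and_div_two, h, pow_zero, one_mul, Nat.mul_div_cancel_left _ two_pos]

lemma land_bit_one_parity (a j : ℕ) :
    (-1 : ℝ) ^ ((Nat.digits 2 (a &&& (2 * j + 1))).sum) =
      (-1 : ℝ) ^ (a % 2) * (-1 : ℝ) ^ ((Nat.digits 2 (a / 2 &&& j)).sum) := by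
  have h : (a &&& (2 * j + 1)) % 2 = a % 2 := by
    have := Nat.and_mod_two_eq_one (a := a) (b := 2 * j + 1)
    omega
  rw [neg_one_pow_digits_sum, Nat.and_div_two, h, show (2 * j + 1) / 2 = j by omega]

lemma sum_range_two_mul {M : Type*} [AddCommMonoid M] (f : ℕ → M) (N : ℕ) :
    ∑ j ∈ range (2 * N), f j = ∑ j ∈ range N, (f (2 * j) + f (2 * j + 1)) := by
  induction N with
  | zero => simp
  | succ N ih =>
    rw [sum_range_succ, ← ih, show 2 * (N + 1) = 2 * N + 1 + 1 by ring, sum_range_succ,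
      sum_range_succ, add_assoc]

lemma sum_range_parity_mul_parity (m : ℕ) : ∀ a b : ℕ, a < 2 ^ m → b < 2 ^ m →
    ∑ j ∈ range (2 ^ m), (-1 : ℝ) ^ ((Nat.digits 2 (a &&& j)).sum) *
      (-1 : ℝ) ^ ((Nat.digits 2 (b &&& j)).sum) = if a = b then (2 : ℝ) ^ m else 0 := by
  induction m with
  | zero =>
    intro a b ha hb
    obtain rfl : a = 0 := by simpa using ha
    obtain rfl : b = 0 := by simpa using hb
    simp
  | succ m ih =>
    intro a b ha hb
    rw [pow_succ'] at ha hb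
    have key := ih (a / 2) (b / 2) (by omega) (by omega)
    rw [pow_succ', sum_range_two_mul]
    have : ∀ j ∈ range (2 ^ m),
        ((-1 : ℝ) ^ ((Nat.digits 2 (a &&& (2 * j))).sum) *
          (-1 : ℝ) ^ ((Nat.digits 2 (b &&& (2 * j))).sum) +
        (-1 : ℝ) ^ ((Nat.digits 2 (a &&& (2 * j + 1))).sum) *
          (-1 : ℝ) ^ ((Nat.digits 2 (b &&& (2 * j + 1))).sum)) =
        (1 + (-1 : ℝ) ^ (a % 2) * (-1 : ℝ) ^ (b % 2)) *
        ((-1 : ℝ) ^ ((Nat.digits 2 (a / 2 &&& j)).sum) *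
          (-1 : ℝ) ^ ((Nat.digits 2 (b / 2 &&& j)).sum)) := by
      intro j _
      rw [land_bit_zero_parity, land_bit_zero_parity, land_bit_one_parity, land_bit_one_parity]
      ring
    rw [sum_congr rfl this, ← mul_sum, key]
    rcases Nat.mod_two_eq_zero_or_one a with h1 | h1 <;>
      rcases Nat.mod_two_eq_zero_or_one b with h2 | h2
    · have : a / 2 = b / 2 ↔ a = b := by omega
      simp only [h1, h2, this]
      split_ifs <;> ring
    · have : a ≠ b := by omega
      simp [h1, h2, this]
    · have : a ≠ b := by omega
      simp [h1, h2, this]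
    · have : a / 2 = b / 2 ↔ a = b := by omega
      simp only [h1, h2, this]
      split_ifs <;> ring

lemma sum_had_mul_had (m : ℕ) (a b : Fin (2 ^ m)) :
    ∑ j, had (2 ^ m) a j * had (2 ^ m) b j = if a = b then (2 : ℝ) ^ m else 0 := by
  have h := sum_range_parity_mul_parity m a b a.2 b.2
  rw [← Fin.sum_univ_eq_sum_range (fun j => (-1 : ℝ) ^ ((Nat.digits 2 (a.1 &&& j)).sum) *
    (-1 : ℝ) ^ ((Nat.digits 2 (b.1 &&& j)).sum))] at h
  simpa [had, Fin.ext_iff] using h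

lemma had_eq_one_or_neg_one (K : ℕ) (a b : Fin K) : had K a b = 1 ∨ had K a b = -1 :=
  neg_one_pow_eq_or ℝ _

lemma had_sq (K : ℕ) (a b : Fin K) : had K a b ^ 2 = 1 := by
  rcases had_eq_one_or_neg_one K a b with h | h <;> simp [h]

/-- The number of users in group `j`. -/
def groupSize (n m : ℕ) (j : Fin (2 ^ m)) : ℕ :=
  (univ.filter fun i : Fin n => grp m i = j).card

lemma le_groupSize (n m : ℕ) (hn : 2 ^ m ≤ n) (j : Fin (2 ^ m)) :
    n ≤ 2 * 2 ^ m * groupSize n m j := by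
  have hK : 0 < 2 ^ m := by positivity
  have hdiv : n / 2 ^ m ≤ groupSize n m j := by
    have hlt : ∀ q : Fin (n / 2 ^ m), 2 ^ m * q.1 + j.1 < n := by
      intro q
      calc 2 ^ m * q.1 + j.1 < 2 ^ m * q.1 + 2 ^ m := by have := j.2; omega
        _ = 2 ^ m * (q.1 + 1) := by ring
        _ ≤ 2 ^ m * (n / 2 ^ m) := Nat.mul_le_mul_left _ q.2
        _ ≤ n := Nat.mul_div_le _ _
    have hcard := Finset.card_le_card_of_injOn (s := (univ : Finset (Fin (n / 2 ^ m))))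
      (t := univ.filter fun i : Fin n => grp m i = j)
      (fun q => (⟨2 ^ m * q.1 + j.1, hlt q⟩ : Fin n))
      (by
        intro q _
        simp [grp, Fin.ext_iff, Nat.mod_eq_of_lt j.2])
      (by
        intro q _ q' _ h
        simpa [Fin.ext_iff] using h)
    simpa [groupSize] using hcard
  have h1 : 1 ≤ n / 2 ^ m := (Nat.one_le_div_iff hK).2 hn
  have h2 := Nat.div_add_mod n (2 ^ m)
  have h3 := Nat.mod_lt n hK
  calc n ≤ 2 ^ m * (n / 2 ^ m) + 2 ^ m * 1 := by omega
    _ ≤ 2 ^ m * (n / 2 ^ m) + 2 ^ m * (n / 2 ^ m) := by gcongr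
    _ = 2 * 2 ^ m * (n / 2 ^ m) := by ring
    _ ≤ _ := by gcongr

lemma groupSize_pos (n m : ℕ) (hn : 2 ^ m ≤ n) (j : Fin (2 ^ m)) : 0 < groupSize n m j := by
  have hK : 0 < 2 ^ m := by positivity
  have := le_groupSize n m hn j
  by_contra h
  have h0 : groupSize n m j = 0 := by omega
  rw [h0] at this
  omega

/-- The probability that a user of group `j` sends `1`. -/
def groupProb {k : ℕ} (m : ℕ) (hk : k ≤ 2 ^ m) (ε : ℝ) (p : Fin k → ℝ) (j : Fin (2 ^ m)) : ℝ :=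
  ∑ x, p x * (if had (2 ^ m) (Fin.castLE hk x) j = 1 then
    Real.exp ε / (Real.exp ε + 1) else 1 / (Real.exp ε + 1))

lemma bitProb_mem_Icc {k n : ℕ} (m : ℕ) (hk : k ≤ 2 ^ m) (ε : ℝ) (p : Fin k → ℝ)
    (hp : probVec p) (i : Fin n) : bitProb m hk ε p i ∈ Set.Icc (0 : ℝ) 1 := by
  have he := Real.exp_pos ε
  constructor
  · refine sum_nonneg fun x _ => mul_nonneg (hp.1 x) ?_
    split_ifs <;> positivity
  · rw [← hp.2]
    refine sum_le_sum fun x _ => mul_le_of_le_one_right (hp.1 x) ?_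
    split_ifs <;> rw [div_le_one (by positivity)] <;> linarith

lemma two_mul_groupProb_sub_one {k : ℕ} (m : ℕ) (hk : k ≤ 2 ^ m) (ε : ℝ) (p : Fin k → ℝ)
    (hp : probVec p) (j : Fin (2 ^ m)) :
    2 * groupProb m hk ε p j - 1 = (Real.exp ε - 1) / (Real.exp ε + 1) *
      ∑ x, had (2 ^ m) (Fin.castLE hk x) j * p x := by
  have he := Real.exp_pos ε
  conv_lhs => rw [← hp.2, groupProb, mul_sum, ← sum_sub_distrib]
  rw [mul_sum]
  refine sum_congr rfl fun x _ => ?_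
  rcases had_eq_one_or_neg_one (2 ^ m) (Fin.castLE hk x) j with h | h
  · rw [h, if_pos rfl]
    field_simp
    ring
  · rw [h, if_neg (by norm_num)]
    field_simp
    ring

lemma eq_sum_had_mul_groupProb {k : ℕ} (m : ℕ) (hk : k ≤ 2 ^ m) (ε : ℝ) (hε : 0 < ε)
    (p : Fin k → ℝ) (hp : probVec p) (x : Fin k) :
    p x = ((Real.exp ε + 1) / (((2 : ℝ) ^ m) * (Real.exp ε - 1))) *
      ∑ j, had (2 ^ m) (Fin.castLE hk x) j * (2 * groupProb m hk ε p j - 1) := by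
  have he : 0 < Real.exp ε - 1 := by
    have := Real.add_one_lt_exp hε.ne'
    linarith
  have h : ∑ j, had (2 ^ m) (Fin.castLE hk x) j * (2 * groupProb m hk ε p j - 1) =
      (Real.exp ε - 1) / (Real.exp ε + 1) * ((2 : ℝ) ^ m * p x) := by
    calc _ = (Real.exp ε - 1) / (Real.exp ε + 1) * ∑ x', p x' *
        ∑ j, had (2 ^ m) (Fin.castLE hk x) j * had (2 ^ m) (Fin.castLE hk x') j := by
          simp_rw [two_mul_groupProb_sub_one m hk ε p hp, mul_sum]
          rw [sum_comm]
          exact sum_congr rfl fun _ _ => sum_congr rfl fun _ _ => by ring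
      _ = _ := by
          simp_rw [sum_had_mul_had, (Fin.castLE_injective hk).eq_iff]
          simp [mul_comm]
  rw [h]
  field_simp

/-- The coefficient of user `i`'s centered bit in the error of coordinate `x`. -/
def errCoeff {k : ℕ} (n m : ℕ) (hk : k ≤ 2 ^ m) (ε : ℝ) (x : Fin k) (i : Fin n) : ℝ :=
  2 * ((Real.exp ε + 1) / (((2 : ℝ) ^ m) * (Real.exp ε - 1))) *
    had (2 ^ m) (Fin.castLE hk x) (grp m i) / groupSize n m (grp m i)

lemma tHat_sub_groupProb {k n : ℕ} (m : ℕ) (hk : k ≤ 2 ^ m) (ε : ℝ) (p : Fin k → ℝ)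
    (hn : 2 ^ m ≤ n) (y : Fin n → Bool) (j : Fin (2 ^ m)) :
    tHat m y j - groupProb m hk ε p j =
      ∑ i with grp m i = j,
        ((if y i then 1 else 0) - bitProb m hk ε p i) / groupSize n m j := by
  have hpos : (0 : ℝ) < groupSize n m j := by exact_mod_cast groupSize_pos n m hn j
  rw [← sum_div, eq_div_iff hpos.ne', sub_mul, sum_sub_distrib]
  congr 1
  · rw [tHat, ← groupSize, div_mul_cancel₀ _ hpos.ne', ← filter_filter]
    simp
  · rw [sum_congr rfl (g := fun _ => groupProb m hk ε p j)]
    · simp [groupSize, mul_comm]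
    · intro i hi
      rw [← (mem_filter.1 hi).2]
      rfl

lemma pTil_sub_eq {k n : ℕ} (m : ℕ) (hk : k ≤ 2 ^ m) (ε : ℝ) (hε : 0 < ε) (p : Fin k → ℝ)
    (hp : probVec p) (hn : 2 ^ m ≤ n) (y : Fin n → Bool) (x : Fin k) :
    pTil m hk ε y x - p x =
      ∑ i, errCoeff n m hk ε x i * ((if y i then 1 else 0) - bitProb m hk ε p i) := by
  conv_lhs => rw [eq_sum_had_mul_groupProb m hk ε hε p hp x]
  rw [pTil, ← mul_sub, ← sum_sub_distrib, mul_sum,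
    ← sum_fiberwise univ (grp m) fun i => errCoeff n m hk ε x i * _]
  refine sum_congr rfl fun j _ => ?_
  have h := tHat_sub_groupProb m hk ε p hn y j
  calc _ = 2 * ((Real.exp ε + 1) / (((2 : ℝ) ^ m) * (Real.exp ε - 1))) *
        had (2 ^ m) (Fin.castLE hk x) j * (tHat m y j - groupProb m hk ε p j) := by ring
    _ = _ := by
      rw [h, mul_sum]
      refine sum_congr rfl fun i hi => ?_
      rw [errCoeff, (mem_filter.1 hi).2]
      ring

lemma sum_errCoeff_sq_le {k n : ℕ} (m : ℕ) (hk : k ≤ 2 ^ m) (ε : ℝ) (hε : 0 < ε)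
    (hn : 2 ^ m ≤ n) (x : Fin k) :
    ∑ i, errCoeff n m hk ε x i ^ 2 ≤
      8 * ((Real.exp ε + 1) / (Real.exp ε - 1)) ^ 2 / n := by
  have hK : (0 : ℝ) < 2 ^ m := by positivity
  have hn0 : (0 : ℝ) < n := by exact_mod_cast (show 0 < 2 ^ m by positivity).trans_le hn
  have he : 0 < Real.exp ε - 1 := by
    have := Real.add_one_lt_exp hε.ne'
    linarith
  set c := (Real.exp ε + 1) / (Real.exp ε - 1) with hc
  rw [← sum_fiberwise univ (grp m) fun i => errCoeff n m hk ε x i ^ 2]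
  calc _ ≤ ∑ _j : Fin (2 ^ m), 8 * c ^ 2 / (2 ^ m * n) := by
        refine sum_le_sum fun j _ => ?_
        have hpos : (0 : ℝ) < groupSize n m j := by exact_mod_cast groupSize_pos n m hn j
        have hle : (n : ℝ) ≤ 2 * 2 ^ m * groupSize n m j := by
          exact_mod_cast le_groupSize n m hn j
        calc _ = ∑ i : Fin n with grp m i = j,
              4 * c ^ 2 / (2 ^ m) ^ 2 / (groupSize n m j : ℝ) ^ 2 := by
              refine sum_congr rfl fun i hi => ?_
              rw [errCoeff, (mem_filter.1 hi).2, div_pow, mul_pow, had_sq, hc]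
              field_simp
              ring
          _ = 4 * c ^ 2 / (2 ^ m) ^ 2 / (groupSize n m j : ℝ) := by
              rw [sum_const, ← groupSize, nsmul_eq_mul]
              field_simp
          _ ≤ _ := by
              rw [div_div, div_le_div_iff₀ (by positivity) (by positivity)]
              nlinarith [mul_le_mul_of_nonneg_left hle
                (show 0 ≤ 4 * c ^ 2 * 2 ^ m by positivity)]
    _ = _ := by
        simp only [sum_const, card_univ, Fintype.card_fin, nsmul_eq_mul]
        push_cast
        field_simp

/-- A form of Hoeffding's lemma for a centered bit. -/
lemma bernoulli_mgf_le_s6 (q a : ℝ) (hq : q ∈ Set.Icc (0 : ℝ) 1) :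
    q * Real.exp (a * (1 - q)) + (1 - q) * Real.exp (a * (0 - q)) ≤ Real.exp (a ^ 2 / 2) := by
  obtain ⟨h0, h1⟩ := hq
  have key : ∀ t : ℝ, -1 ≤ t → t ≤ 1 →
      Real.exp (a * t) ≤ (1 + t) / 2 * Real.exp a + (1 - t) / 2 * Real.exp (-a) := by
    intro t ht0 ht1
    have h := convexOn_exp.2 (Set.mem_univ a) (Set.mem_univ (-a))
      (show 0 ≤ (1 + t) / 2 by linarith) (show 0 ≤ (1 - t) / 2 by linarith) (by ring)
    simp only [smul_eq_mul] at h
    rwa [show (1 + t) / 2 * a + (1 - t) / 2 * -a = a * t by ring] at h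
  calc _ ≤ q * ((1 + (1 - q)) / 2 * Real.exp a + (1 - (1 - q)) / 2 * Real.exp (-a)) +
        (1 - q) * ((1 + (0 - q)) / 2 * Real.exp a + (1 - (0 - q)) / 2 * Real.exp (-a)) := by
        have h1q : 0 ≤ 1 - q := by linarith
        gcongr
        · exact key _ (by linarith) (by linarith)
        · exact key _ (by linarith) (by linarith)
    _ = Real.cosh a := by rw [Real.cosh_eq]; ring
    _ ≤ _ := Real.cosh_le_exp_half_sq a

/-- A sub-Gaussian moment generating function gives an exponential moment of the square. -/
lemma sum_mul_exp_sq_le_two {ι : Type*} [Fintype ι] (w Z : ι → ℝ) (v l : ℝ)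
    (hl : 0 ≤ l) (hlv : l * v ≤ 1 / 4)
    (hmgf : ∀ θ : ℝ, ∑ i, w i * Real.exp (θ * Z i) ≤ Real.exp (θ ^ 2 * v / 2)) :
    ∑ i, w i * Real.exp (l * Z i ^ 2) ≤ 2 := by
  have hpi : 0 < √π := Real.sqrt_pos.2 Real.pi_pos
  have hshift : ∀ z x : ℝ, Real.exp (-x ^ 2) * Real.exp (2 * √l * x * z) =
      Real.exp (l * z ^ 2) * Real.exp (-1 * (x - √l * z) ^ 2) := by
    intro z x
    rw [← Real.exp_add, ← Real.exp_add]
    congr 1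
    nlinarith [Real.sq_sqrt hl]
  have hint : ∀ z : ℝ, MeasureTheory.Integrable
      (fun x : ℝ => Real.exp (-x ^ 2) * Real.exp (2 * √l * x * z)) := by
    intro z
    simp_rw [hshift]
    exact ((integrable_exp_neg_mul_sq one_pos).comp_sub_right (√l * z)).const_mul _
  have hval : ∀ z : ℝ, ∫ x : ℝ, Real.exp (-x ^ 2) * Real.exp (2 * √l * x * z) =
      √π * Real.exp (l * z ^ 2) := by
    intro z
    simp_rw [hshift]
    rw [MeasureTheory.integral_const_mul,
      MeasureTheory.integral_sub_right_eq_self (fun x : ℝ => Real.exp (-1 * x ^ 2)),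
      integral_gaussian]
    simp [mul_comm]
  have hmain : √π * ∑ i, w i * Real.exp (l * Z i ^ 2) ≤ √(π / (1 / 2)) := by
    calc _ = ∑ i, w i * ∫ x : ℝ, Real.exp (-x ^ 2) * Real.exp (2 * √l * x * Z i) := by
          simp_rw [hval, mul_sum]
          exact sum_congr rfl fun _ _ => by ring
      _ = ∫ x : ℝ, ∑ i, w i * (Real.exp (-x ^ 2) * Real.exp (2 * √l * x * Z i)) := by
          rw [MeasureTheory.integral_finsetSum _ fun i _ => (hint (Z i)).const_mul _]
          simp_rw [MeasureTheory.integral_const_mul]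
      _ ≤ ∫ x : ℝ, Real.exp (-(1 / 2) * x ^ 2) := by
          refine MeasureTheory.integral_mono
            (MeasureTheory.integrable_finsetSum _ fun i _ => (hint (Z i)).const_mul _)
            (integrable_exp_neg_mul_sq (by norm_num)) fun x => ?_
          calc _ = Real.exp (-x ^ 2) * ∑ i, w i * Real.exp (2 * √l * x * Z i) := by
                rw [mul_sum]
                exact sum_congr rfl fun _ _ => by ring
            _ ≤ Real.exp (-x ^ 2) * Real.exp ((2 * √l * x) ^ 2 * v / 2) := by
                gcongr
                exact hmgf _
            _ ≤ _ := by
                rw [← Real.exp_add]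
                refine Real.exp_le_exp.2 ?_
                rw [mul_pow, mul_pow, Real.sq_sqrt hl]
                nlinarith [mul_le_mul_of_nonneg_right hlv (sq_nonneg x)]
      _ = _ := integral_gaussian _
  have hle : √(π / (1 / 2)) ≤ √π * 2 := by
    rw [Real.sqrt_le_left (by positivity), mul_pow, Real.sq_sqrt Real.pi_pos.le]
    nlinarith [Real.pi_pos]
  exact le_of_mul_le_mul_left (hmain.trans hle) hpi

lemma outP_nonneg {k n : ℕ} (m : ℕ) (hk : k ≤ 2 ^ m) (ε : ℝ) (p : Fin k → ℝ)
    (hp : probVec p) (y : Fin n → Bool) : 0 ≤ outP m hk ε p y := by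
  refine prod_nonneg fun i _ => ?_
  have h := bitProb_mem_Icc m hk ε p hp i
  split_ifs
  · exact h.1
  · linarith [h.2]

lemma sum_outP_mul_prod {k n : ℕ} (m : ℕ) (hk : k ≤ 2 ^ m) (ε : ℝ) (p : Fin k → ℝ)
    (f : Fin n → Bool → ℝ) :
    ∑ y, outP m hk ε p y * ∏ i, f i (y i) =
      ∏ i, (bitProb m hk ε p i * f i true + (1 - bitProb m hk ε p i) * f i false) := by
  simp_rw [outP, ← prod_mul_distrib]
  rw [← Fintype.prod_sum fun i b =>
    (if b = true then bitProb m hk ε p i else 1 - bitProb m hk ε p i) * f i b]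
  simp

lemma sum_outP {k n : ℕ} (m : ℕ) (hk : k ≤ 2 ^ m) (ε : ℝ) (p : Fin k → ℝ) :
    ∑ y : Fin n → Bool, outP m hk ε p y = 1 := by
  simpa using sum_outP_mul_prod (n := n) m hk ε p fun _ _ => 1

lemma pTil_error_mgf_le {k n : ℕ} (m : ℕ) (hk : k ≤ 2 ^ m) (ε : ℝ) (hε : 0 < ε)
    (p : Fin k → ℝ) (hp : probVec p) (hn : 2 ^ m ≤ n) (x : Fin k) (θ : ℝ) :
    ∑ y : Fin n → Bool, outP m hk ε p y * Real.exp (θ * (pTil m hk ε y x - p x)) ≤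
      Real.exp (θ ^ 2 * (8 * ((Real.exp ε + 1) / (Real.exp ε - 1)) ^ 2 / n) / 2) := by
  set a : Fin n → ℝ := errCoeff n m hk ε x
  calc _ = ∑ y : Fin n → Bool, outP m hk ε p y * ∏ i,
        Real.exp (θ * a i * ((if y i then 1 else 0) - bitProb m hk ε p i)) := by
        refine sum_congr rfl fun y _ => ?_
        rw [pTil_sub_eq m hk ε hε p hp hn, mul_sum, Real.exp_sum]
        simp_rw [mul_assoc]
        rfl
    _ = ∏ i, (bitProb m hk ε p i * Real.exp (θ * a i * (1 - bitProb m hk ε p i)) +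
          (1 - bitProb m hk ε p i) * Real.exp (θ * a i * (0 - bitProb m hk ε p i))) := by
        rw [sum_outP_mul_prod m hk ε p fun i b =>
          Real.exp (θ * a i * ((if b = true then 1 else 0) - bitProb m hk ε p i))]
        simp
    _ ≤ ∏ i, Real.exp ((θ * a i) ^ 2 / 2) := by
        refine prod_le_prod (fun i _ => ?_) fun i _ =>
          bernoulli_mgf_le_s6 _ _ (bitProb_mem_Icc m hk ε p hp i)
        have h := bitProb_mem_Icc m hk ε p hp i
        have h1 : 0 ≤ 1 - bitProb m hk ε p i := by linarith [h.2]
        exact add_nonneg (mul_nonneg h.1 (Real.exp_pos _).le) (mul_nonneg h1 (Real.exp_pos _).le)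
    _ = Real.exp (θ ^ 2 * (∑ i, a i ^ 2) / 2) := by
        rw [← Real.exp_sum, ← sum_div, mul_sum]
        simp_rw [mul_pow]
    _ ≤ _ := by
        gcongr
        exact sum_errCoeff_sq_le m hk ε hε hn x

/-- If `∑ exp (l Zₓ²)` is at most `20 k`, every block of at most `2 s` coordinates of `Z` has
small energy. -/
lemma mul_sum_sq_le_of_sum_exp_le {ι : Type*} [Fintype ι] (Z : ι → ℝ) (T : Finset ι)
    (l k s : ℝ) (hs : 0 < s) (hsk : 100 * s ≤ k) (hT : (T.card : ℝ) ≤ 2 * s)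
    (hsum : ∑ x, Real.exp (l * Z x ^ 2) ≤ 20 * k) :
    l * ∑ x ∈ T, Z x ^ 2 ≤ 4 * s * Real.log (2 * k / s) := by
  have hk : 0 < k := by linarith
  set r := 2 * k / s with hr
  have hr200 : 200 ≤ r := by rw [hr, le_div_iff₀ hs]; linarith
  have hr0 : 0 < r := by linarith
  have hlog : 1 ≤ Real.log r := by
    rw [Real.le_log_iff_exp_le hr0]
    linarith [Real.exp_one_lt_d9]
  have hpt : ∀ x, l * Z x ^ 2 ≤ Real.exp (l * Z x ^ 2) / r ^ 2 + (2 * Real.log r - 1) := by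
    intro x
    have h := Real.log_le_sub_one_of_pos
      (show 0 < Real.exp (l * Z x ^ 2) / r ^ 2 by positivity)
    rw [Real.log_div (Real.exp_pos _).ne' (by positivity), Real.log_exp, Real.log_pow] at h
    push_cast at h
    linarith
  calc _ = ∑ x ∈ T, l * Z x ^ 2 := mul_sum _ _ _
    _ ≤ ∑ x ∈ T, (Real.exp (l * Z x ^ 2) / r ^ 2 + (2 * Real.log r - 1)) :=
        sum_le_sum fun x _ => hpt x
    _ = (∑ x ∈ T, Real.exp (l * Z x ^ 2)) / r ^ 2 + T.card * (2 * Real.log r - 1) := by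
        rw [sum_add_distrib, sum_const, nsmul_eq_mul, sum_div]
    _ ≤ 20 * k / r ^ 2 + 2 * s * (2 * Real.log r - 1) := by
        have h0 : 0 ≤ 2 * Real.log r - 1 := by linarith
        gcongr
        exact (sum_le_univ_sum_of_nonneg fun x => (Real.exp_pos _).le).trans hsum
    _ ≤ _ := by
        have hkr : 20 * k / r ^ 2 ≤ 2 * s := by
          have hks : 2 * k = r * s := by rw [hr]; field_simp
          rw [div_le_iff₀ (by positivity)]
          nlinarith [mul_pos hr0 hs]
        linarith

lemma card_filter_sub_ne_zero_le {k : ℕ} (p q : Fin k → ℝ) :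
    (univ.filter fun x => q x - p x ≠ 0).card ≤ suppSize q + suppSize p := by
  refine le_trans (card_le_card fun x hx => ?_) (card_union_le _ _)
  simp only [mem_filter, mem_univ, true_and, mem_union] at hx ⊢
  by_contra h
  push Not at h
  exact hx (by rw [h.1, h.2, sub_zero])

lemma sum_mul_le_sqrt_support {ι : Type*} [Fintype ι] (Z u : ι → ℝ) :
    ∑ x, Z x * u x ≤ √(∑ x with u x ≠ 0, Z x ^ 2) * √(∑ x, u x ^ 2) := by
  calc ∑ x, Z x * u x = ∑ x with u x ≠ 0, Z x * u x := by
        symm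
        refine sum_filter_of_ne fun x _ h hu => h ?_
        rw [hu, mul_zero]
    _ ≤ √(∑ x with u x ≠ 0, Z x ^ 2) * √(∑ x with u x ≠ 0, u x ^ 2) :=
        Real.sum_mul_le_sqrt_mul_sqrt _ _ _
    _ ≤ _ := by
        gcongr
        exact subset_univ _

/-- Lemma 1: in the 1-bit Hadamard Response with projection scheme (here `phat y` is the
ℓ₂-projection of the intermediate estimate `pTil … y` onto `Δ_{k,s}`), with probability at
least `9/10`,
`⟨p̃ − p, p̂ − p⟩ ≤ 25 ((e^ε+1)/(e^ε−1)) √(s log(2k/s)/n) ‖p̂ − p‖₂`. -/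
theorem lemma1_hr_inner_product_bound
    (k s n m : ℕ) (ε : ℝ) (p : Fin k → ℝ)
    (phat : (Fin n → Bool) → Fin k → ℝ)
    (hk2 : 2 ≤ k) (hs1 : 1 ≤ s) (hsk : 100 * s ≤ k) (hε : 0 < ε)
    (hkm : k < 2 ^ m) (hmk : 2 ^ m ≤ 2 * k) (hnK : 2 ^ m ≤ n)
    (hp : probVec p) (hps : suppSize p ≤ s)
    (hproj : ∀ y : Fin n → Bool,
      probVec (phat y) ∧ suppSize (phat y) ≤ s ∧
      ∀ q : Fin k → ℝ, probVec q → suppSize q ≤ s →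
        ∑ x, (pTil m hkm.le ε y x - phat y x) ^ 2 ≤
          ∑ x, (pTil m hkm.le ε y x - q x) ^ 2) :
    (9 : ℝ) / 10 ≤
      ∑ y : Fin n → Bool, outP m hkm.le ε p y *
        (if ∑ x, (pTil m hkm.le ε y x - p x) * (phat y x - p x) ≤
            25 * ((Real.exp ε + 1) / (Real.exp ε - 1)) *
              Real.sqrt ((s : ℝ) * Real.log (2 * (k : ℝ) / (s : ℝ)) / (n : ℝ)) *
              Real.sqrt (∑ x, (phat y x - p x) ^ 2)
          then 1 else 0) := by
  set c := (Real.exp ε + 1) / (Real.exp ε - 1) with hc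
  have he : 0 < Real.exp ε - 1 := by
    have := Real.add_one_lt_exp hε.ne'
    linarith
  have hc0 : 0 < c := by positivity
  have hn0 : (0 : ℝ) < n := by exact_mod_cast (show 0 < 2 ^ m by positivity).trans_le hnK
  have hk0 : (0 : ℝ) < k := by exact_mod_cast (show 0 < k by omega)
  have hs0 : (0 : ℝ) < s := by exact_mod_cast hs1
  have hskR : 100 * (s : ℝ) ≤ k := by exact_mod_cast hsk
  set l : ℝ := n / (32 * c ^ 2) with hl
  have hl0 : 0 < l := by positivity
  set Z : (Fin n → Bool) → Fin k → ℝ := fun y x => pTil m hkm.le ε y x - p x with hZ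
  set M : (Fin n → Bool) → ℝ := fun y => ∑ x, Real.exp (l * Z y x ^ 2) with hM
  have hEM : ∑ y, outP m hkm.le ε p y * M y ≤ 2 * k := by
    calc _ = ∑ x, ∑ y, outP m hkm.le ε p y * Real.exp (l * Z y x ^ 2) := by
          simp_rw [hM, mul_sum]
          exact sum_comm
      _ ≤ ∑ _x : Fin k, (2 : ℝ) := by
          refine sum_le_sum fun x _ => sum_mul_exp_sq_le_two _ _ (8 * c ^ 2 / n) l hl0.le ?_
            fun θ => pTil_error_mgf_le m hkm.le ε hε p hp hnK x θ
          rw [hl]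
          apply le_of_eq
          field_simp
          norm_num
      _ = _ := by simp [mul_comm]
  have hgood : ∀ y, M y ≤ 20 * k →
      ∑ x, Z y x * (phat y x - p x) ≤
        25 * c * √((s : ℝ) * Real.log (2 * (k : ℝ) / (s : ℝ)) / n) *
          √(∑ x, (phat y x - p x) ^ 2) := by
    intro y hy
    refine (sum_mul_le_sqrt_support (Z y) fun x => phat y x - p x).trans ?_
    gcongr
    have hcard : ((univ.filter fun x => phat y x - p x ≠ 0).card : ℝ) ≤ 2 * s := by
      have h1 := card_filter_sub_ne_zero_le p (phat y)
      have h2 := (hproj y).2.1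
      have h3 := h1.trans (show _ ≤ 2 * s by omega)
      exact_mod_cast h3
    have hen := mul_sum_sq_le_of_sum_exp_le (Z y) _ l k s hs0 hskR hcard hy
    have hlog : 0 ≤ Real.log (2 * (k : ℝ) / s) := by
      apply Real.log_nonneg
      rw [le_div_iff₀ hs0]
      linarith
    rw [Real.sqrt_le_left (by positivity), mul_pow, Real.sq_sqrt (by positivity)]
    refine le_of_mul_le_mul_left (hen.trans ?_) hl0
    have hcalc : l * ((25 * c) ^ 2 * (s * Real.log (2 * (k : ℝ) / s) / n)) =
        625 / 32 * (s * Real.log (2 * (k : ℝ) / s)) := by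
      rw [hl]
      field_simp
      ring
    rw [hcalc]
    nlinarith [mul_nonneg hs0.le hlog]
  calc (9 : ℝ) / 10 ≤ 1 - (∑ y, outP m hkm.le ε p y * M y) / (20 * k) := by
        have : (∑ y, outP m hkm.le ε p y * M y) / (20 * k) ≤ 1 / 10 := by
          rw [div_le_iff₀ (by positivity)]
          linarith
        linarith
    _ = ∑ y, outP m hkm.le ε p y * (1 - M y / (20 * k)) := by
        simp_rw [mul_sub, mul_one, sum_sub_distrib, sum_outP, sum_div, mul_div_assoc]
    _ ≤ _ := by
        refine sum_le_sum fun y _ =>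
          mul_le_mul_of_nonneg_left ?_ (outP_nonneg m hkm.le ε p hp y)
        have hM0 : 0 ≤ M y := sum_nonneg fun _ _ => (Real.exp_pos _).le
        split_ifs with h
        · have : 0 ≤ M y / (20 * k) := by positivity
          linarith
        · have hlt : 20 * (k : ℝ) < M y := not_le.1 fun hle => h (hgood y hle)
          have : 1 ≤ M y / (20 * k) := (one_le_div (by positivity)).2 hlt.le
          linarith
end
end

section
/- (Lemma 2, Fano-type inequality with Hamming balls.) Let Z ⊆ {0,1}^k be a finite set and let Z be uniformly distributed on Z. For t ≥ 0 let N_t^max = max_{z∈Z} #{z' ∈ Z : d_H(z, z') ≤ t}, where d_H is Hamming distance. Suppose |Z| ≥ 2·N_t^max. Then for any Markov chain Z → Y^n → Ẑ with Ẑ taking values in Z, Pr(d_H(Ẑ, Z) > t) ≥ 1 − (I(Z; Y^n) + log 2)/(log |Z| − log N_t^max). -/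
open Real BigOperators Finset
open scoped Classical

noncomputable section

/-- Mutual information `I(Z;Y)` when `Z` is uniform on the finite set `ZS` and
`P z` is the conditional distribution of `Y` given `Z = z` (so the joint pmf is
`|ZS|⁻¹ · P z y`, the `Z`-marginal is uniform, and the `Y`-marginal is
`|ZS|⁻¹ Σ_{z'} P z' y`). -/
def miUniform {Z Y : Type*} [Fintype Y] (ZS : Finset Z) (P : Z → Y → ℝ) : ℝ :=
  ∑ z ∈ ZS, ∑ y,
    ((ZS.card : ℝ)⁻¹ * P z y) *
      Real.log (((ZS.card : ℝ)⁻¹ * P z y) /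
        ((ZS.card : ℝ)⁻¹ * ((ZS.card : ℝ)⁻¹ * ∑ z' ∈ ZS, P z' y)))

/-- Tangent-line form of the Gibbs variational inequality. -/
theorem mul_sub_mul_exp_add_le_mul_log_div {a b : ℝ} (ha : 0 ≤ a) (hb : 0 ≤ b)
    (hab : b = 0 → a = 0) (u : ℝ) : a * u - b * exp u + a ≤ a * log (a / b) := by
  rcases ha.eq_or_lt with rfl | ha
  · have := mul_nonneg hb (exp_pos u).le
    simpa using this
  have hb : 0 < b := hb.lt_of_ne fun h => ha.ne' (hab h.symm)
  have key := log_le_sub_one_of_pos (show 0 < b * exp u / a by positivity)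
  rw [log_div (by positivity) ha.ne', log_mul hb.ne' (exp_pos u).ne', log_exp] at key
  rw [log_div ha.ne' hb.ne']
  have h := mul_le_mul_of_nonneg_left key ha.le
  have e : a * (b * exp u / a - 1) = b * exp u - a := by field_simp
  linarith

/-- A Fano inequality for an arbitrary error event `bad`: if every estimate is acceptable for at
most `N` elements of `S`, then `(1 - Pr(bad)) (log |S| - log N) ≤ I(Z;Y) + log 2`. -/
theorem one_sub_error_mul_le_miUniform_add_log_two {α Y : Type*} [Fintype Y]
    (S : Finset α) (hS : S.Nonempty) (W : α → Y → ℝ)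
    (hW : ∀ z ∈ S, (∀ y, 0 ≤ W z y) ∧ ∑ y, W z y = 1) (Q : Y → α → ℝ)
    (hQ : ∀ y, (∀ zh, 0 ≤ Q y zh) ∧ ∑ zh ∈ S, Q y zh = 1)
    (bad : α → α → Prop) (N : ℕ) (hN : 0 < N)
    (hball : ∀ zh ∈ S, (S.filter fun z => ¬ bad z zh).card ≤ N) :
    (1 - ∑ z ∈ S, ∑ y, ∑ zh ∈ S,
        (S.card : ℝ)⁻¹ * W z y * Q y zh * (if bad z zh then 1 else 0)) *
      (log (S.card : ℝ) - log (N : ℝ)) ≤ miUniform S W + log 2 := by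
  have hM : (0 : ℝ) < S.card := by exact_mod_cast hS.card_pos
  have hN' : (0 : ℝ) < N := by exact_mod_cast hN
  set M : ℝ := (S.card : ℝ) with hMdef
  set D : ℝ := log M - log N with hD
  let p : Y → ℝ := fun y => M⁻¹ * ∑ z ∈ S, W z y
  let u : α → α → ℝ := fun z zh => (1 - if bad z zh then 1 else 0) * D - log 2
  have hp : ∀ y, 0 ≤ p y := fun y =>
    mul_nonneg (inv_nonneg.2 hM.le) (sum_nonneg fun z hz => (hW z hz).1 y)
  have hp_sum : ∑ y, p y = 1 := by
    simp only [p]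
    rw [← mul_sum, sum_comm, sum_congr rfl fun z hz => (hW z hz).2]
    simp [← hMdef, hM.ne']
  have hjoint : ∑ z ∈ S, ∑ y, ∑ zh ∈ S, Q y zh * (M⁻¹ * W z y) = 1 := by
    simp only [← sum_mul, (hQ _).2, one_mul, ← mul_sum]
    rw [sum_congr rfl fun z hz => (hW z hz).2]
    simp [← hMdef, hM.ne']
  have hexp : ∀ z zh, exp (u z zh) ≤ 1 / 2 + (if ¬ bad z zh then 1 else 0) * (M / (2 * N)) := by
    intro z zh
    by_cases h : bad z zh
    · simp [u, h, exp_neg, exp_log]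
    · have : exp (u z zh) = M / (2 * N) := by
        simp only [u, h, if_false, hD, sub_zero, one_mul, exp_sub, exp_log hM, exp_log hN',
          exp_log (zero_lt_two' ℝ)]
        field_simp
      rw [this]
      simp [h]
  have hcorr : ∑ z ∈ S, ∑ y, ∑ zh ∈ S, Q y zh * (M⁻¹ * p y * exp (u z zh)) ≤ 1 := by
    have hz : ∀ zh ∈ S, ∑ z ∈ S, exp (u z zh) ≤ M := by
      intro zh hzh
      refine (sum_le_sum fun z _ => hexp z zh).trans ?_
      rw [sum_add_distrib, ← sum_mul, sum_boole, sum_const, nsmul_eq_mul, ← hMdef]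
      have h1 : ((S.filter fun z => ¬ bad z zh).card : ℝ) ≤ N := by exact_mod_cast hball zh hzh
      have h2 := mul_le_mul_of_nonneg_right h1 (show 0 ≤ M / (2 * N) by positivity)
      have h3 : (N : ℝ) * (M / (2 * N)) = M / 2 := by field_simp
      linarith
    calc ∑ z ∈ S, ∑ y, ∑ zh ∈ S, Q y zh * (M⁻¹ * p y * exp (u z zh))
        = ∑ y, ∑ zh ∈ S, Q y zh * (M⁻¹ * p y) * ∑ z ∈ S, exp (u z zh) := by
          rw [sum_comm]
          refine sum_congr rfl fun y _ => ?_
          rw [sum_comm]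
          refine sum_congr rfl fun zh _ => ?_
          rw [mul_sum]
          exact sum_congr rfl fun z _ => by ring
      _ ≤ ∑ y, ∑ zh ∈ S, Q y zh * (M⁻¹ * p y) * M := by
          refine sum_le_sum fun y _ => sum_le_sum fun zh hzh => ?_
          exact mul_le_mul_of_nonneg_left (hz zh hzh)
            (mul_nonneg ((hQ y).1 zh) (mul_nonneg (inv_nonneg.2 hM.le) (hp y)))
      _ = 1 := by
          simp only [← sum_mul, (hQ _).2, one_mul, ← mul_sum, hp_sum]
          field_simp
  have hmi : miUniform S W = ∑ z ∈ S, ∑ y, ∑ zh ∈ S,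
      Q y zh * (M⁻¹ * W z y * log (M⁻¹ * W z y / (M⁻¹ * p y))) := by
    simp only [← sum_mul, (hQ _).2, one_mul]
    rfl
  have hgibbs : ∑ z ∈ S, ∑ y, ∑ zh ∈ S,
      Q y zh * (M⁻¹ * W z y * u z zh - M⁻¹ * p y * exp (u z zh) + M⁻¹ * W z y) ≤
        miUniform S W := by
    rw [hmi]
    refine sum_le_sum fun z hz => sum_le_sum fun y _ => sum_le_sum fun zh _ => ?_
    refine mul_le_mul_of_nonneg_left ?_ ((hQ y).1 zh)
    refine mul_sub_mul_exp_add_le_mul_log_div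
      (mul_nonneg (inv_nonneg.2 hM.le) ((hW z hz).1 y))
      (mul_nonneg (inv_nonneg.2 hM.le) (hp y)) (fun h => ?_) _
    have h0 : ∑ z ∈ S, W z y = 0 := by simpa [p, hM.ne'] using h
    rw [(sum_eq_zero_iff_of_nonneg fun z hz => (hW z hz).1 y).1 h0 z hz, mul_zero]
  have hsplit : ∑ z ∈ S, ∑ y, ∑ zh ∈ S,
      Q y zh * (M⁻¹ * W z y * u z zh - M⁻¹ * p y * exp (u z zh) + M⁻¹ * W z y) =
      (D - log 2 + 1) * ∑ z ∈ S, ∑ y, ∑ zh ∈ S, Q y zh * (M⁻¹ * W z y) -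
      D * ∑ z ∈ S, ∑ y, ∑ zh ∈ S, M⁻¹ * W z y * Q y zh * (if bad z zh then 1 else 0) -
      ∑ z ∈ S, ∑ y, ∑ zh ∈ S, Q y zh * (M⁻¹ * p y * exp (u z zh)) := by
    simp only [mul_sum, ← sum_sub_distrib]
    refine sum_congr rfl fun z _ => sum_congr rfl fun y _ => sum_congr rfl fun zh _ => ?_
    simp only [u]
    ring
  rw [hsplit, hjoint] at hgibbs
  linarith

/-- Lemma 2 (Fano-type inequality with Hamming balls). `Z` is uniform on a finite set
`ZS ⊆ {0,1}^k`; `W z` is the conditional law of `Y^n` given `Z = z`; `Q y` is the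
conditional law of `Ẑ ∈ ZS` given `Y^n = y` (Markov chain `Z → Y^n → Ẑ`).
If `|ZS| ≥ 2 N_t^max` then
`Pr(d_H(Ẑ,Z) > t) ≥ 1 − (I(Z;Y^n) + log 2)/(log |ZS| − log N_t^max)`. -/
theorem fano_hamming (k t : ℕ) (ZS : Finset (Fin k → Bool)) (hZS : ZS.Nonempty)
    (Y : Type) [Fintype Y]
    (W : (Fin k → Bool) → Y → ℝ)
    (hW : ∀ z ∈ ZS, (∀ y, 0 ≤ W z y) ∧ ∑ y, W z y = 1)
    (Q : Y → (Fin k → Bool) → ℝ)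
    (hQ : ∀ y, (∀ zh, 0 ≤ Q y zh) ∧ ∑ zh ∈ ZS, Q y zh = 1)
    (N : ℕ)
    (hN : N = ZS.sup fun z => (ZS.filter fun z' => hammingDist z z' ≤ t).card)
    (hsize : 2 * N ≤ ZS.card) :
    1 - (miUniform ZS W + Real.log 2) / (Real.log (ZS.card : ℝ) - Real.log (N : ℝ)) ≤
      ∑ z ∈ ZS, ∑ y : Y, ∑ zh ∈ ZS,
        (ZS.card : ℝ)⁻¹ * W z y * Q y zh * (if t < hammingDist z zh then 1 else 0) := by
  have hcard : ∀ z ∈ ZS, (ZS.filter fun z' => hammingDist z z' ≤ t).card ≤ N := fun z hz =>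
    hN ▸ le_sup (f := fun z => (ZS.filter fun z' => hammingDist z z' ≤ t).card) hz
  have hNpos : 0 < N := by
    obtain ⟨z, hz⟩ := hZS
    exact (card_pos.2 ⟨z, by simp [hz]⟩).trans_le (hcard z hz)
  have hD : 0 < log (ZS.card : ℝ) - log (N : ℝ) :=
    sub_pos.2 (log_lt_log (by exact_mod_cast hNpos) (by exact_mod_cast (by omega : N < ZS.card)))
  have key := one_sub_error_mul_le_miUniform_add_log_two ZS hZS W hW Q hQ
    (fun z zh => t < hammingDist z zh) N hNpos fun zh hzh => by
      simpa only [not_lt, hammingDist_comm _ zh] using hcard zh hzh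
  rw [sub_le_comm, le_div_iff₀ hD]
  refine le_trans (le_of_eq ?_) key
  congr!
end
end

section
/- (Lemma 4, packing bound.) Let 1 ≤ s ≤ k/100 with s even, let Z_{k,s} ⊆ {0,1}^k be the set of binary strings with exactly s ones, and let N_{s/2}^max = max_{z∈Z_{k,s}} #{z' ∈ Z_{k,s} : d_H(z, z') ≤ s/2}. Then log |Z_{k,s}| − log N_{s/2}^max ≥ (s/8)·log(k/s). -/
open Real BigOperators Finset
open scoped Classical

noncomputable section

/-- `Z_{k,s}`: binary strings of length `k` with exactly `s` ones. -/
def sparseVecs (k s : ℕ) : Finset (Fin k → Bool) :=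
  Finset.univ.filter fun z => (Finset.univ.filter fun x => z x = true).card = s

/-- `N_{s/2}^max`: the maximum number of elements of `Z_{k,s}` in a Hamming ball of radius `s/2`. -/
def maxBall (k s : ℕ) : ℕ :=
  (sparseVecs k s).sup fun z => ((sparseVecs k s).filter fun z' => hammingDist z z' ≤ s / 2).card

/-- The support of a binary string. -/
def boolSupport {k : ℕ} (z : Fin k → Bool) : Finset (Fin k) :=
  Finset.univ.filter fun x => z x = true

lemma mem_boolSupport {k : ℕ} {z : Fin k → Bool} {x : Fin k} :
    x ∈ boolSupport z ↔ z x = true := by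
  simp [boolSupport]

lemma boolSupport_injective {k : ℕ} :
    Function.Injective (boolSupport : (Fin k → Bool) → Finset (Fin k)) := by
  intro z w h
  funext x
  rw [Bool.eq_iff_iff, ← mem_boolSupport, ← mem_boolSupport, h]

lemma mem_sparseVecs {k s : ℕ} {z : Fin k → Bool} :
    z ∈ sparseVecs k s ↔ (boolSupport z).card = s := by
  simp [sparseVecs, boolSupport]

lemma card_sparseVecs (k s : ℕ) : (sparseVecs k s).card = k.choose s := by
  have himage : (sparseVecs k s).image boolSupport = powersetCard s univ := by
    ext A
    simp only [mem_image, mem_sparseVecs, mem_powersetCard_univ]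
    constructor
    · rintro ⟨z, hz, rfl⟩
      exact hz
    · intro hA
      have hsupp : boolSupport (fun x => decide (x ∈ A)) = A := by
        ext x
        simp [mem_boolSupport]
      exact ⟨_, by rw [hsupp, hA], hsupp⟩
  rw [← card_image_of_injective _ boolSupport_injective, himage, card_powersetCard, card_univ,
    Fintype.card_fin]

lemma card_sparseVecs_superset_le {k s : ℕ} (T : Finset (Fin k)) :
    ((sparseVecs k s).filter fun z => T ⊆ boolSupport z).card ≤
      (k - T.card).choose (s - T.card) := by
  have hcard : (powersetCard (s - T.card) Tᶜ).card = (k - T.card).choose (s - T.card) := by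
    rw [card_powersetCard, card_compl, Fintype.card_fin]
  rw [← hcard]
  refine card_le_card_of_injOn (fun z => boolSupport z \ T) ?_ ?_
  · intro z hz
    obtain ⟨hz, hT⟩ := mem_filter.1 hz
    refine mem_powersetCard.2 ⟨?_, ?_⟩
    · intro x hx
      exact mem_compl.2 (mem_sdiff.1 hx).2
    · rw [card_sdiff_of_subset hT, mem_sparseVecs.1 hz]
  · intro z hz w hw h
    apply boolSupport_injective
    rw [← sdiff_union_of_subset (mem_filter.1 hz).2, ← sdiff_union_of_subset (mem_filter.1 hw).2]
    exact congrArg (· ∪ T) h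

/-- Two strings with `s` ones at distance at most `r` share at least `s - r / 2` ones. -/
lemma le_card_boolSupport_inter {k s r : ℕ} {z w : Fin k → Bool} (hz : z ∈ sparseVecs k s)
    (hw : w ∈ sparseVecs k s) (h : hammingDist z w ≤ r) :
    s - r / 2 ≤ (boolSupport z ∩ boolSupport w).card := by
  rw [mem_sparseVecs] at hz hw
  have hdist : (boolSupport z \ boolSupport w).card + (boolSupport w \ boolSupport z).card ≤
      hammingDist z w := by
    rw [← card_union_of_disjoint disjoint_sdiff_sdiff, hammingDist]
    apply card_le_card
    intro x
    simp only [mem_union, mem_sdiff, mem_boolSupport, mem_filter, mem_univ, true_and]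
    grind
  have hz' := card_sdiff_add_card_inter (boolSupport z) (boolSupport w)
  have hw' := card_sdiff_add_card_inter (boolSupport w) (boolSupport z)
  rw [inter_comm] at hw'
  omega

lemma maxBall_le (k s : ℕ) :
    maxBall k s ≤ s.choose (s - s / 2 / 2) *
      (k - (s - s / 2 / 2)).choose (s - (s - s / 2 / 2)) := by
  set t := s - s / 2 / 2
  refine Finset.sup_le fun z hz => ?_
  have hcover : ((sparseVecs k s).filter fun w => hammingDist z w ≤ s / 2) ⊆
      (powersetCard t (boolSupport z)).biUnion fun T =>
        (sparseVecs k s).filter fun w => T ⊆ boolSupport w := by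
    intro w hw
    obtain ⟨hw, hzw⟩ := mem_filter.1 hw
    obtain ⟨T, hT, hTcard⟩ := exists_subset_card_eq (le_card_boolSupport_inter hz hw hzw)
    exact mem_biUnion.2 ⟨T, mem_powersetCard.2 ⟨hT.trans inter_subset_left, hTcard⟩,
      mem_filter.2 ⟨hw, hT.trans inter_subset_right⟩⟩
  refine (card_le_card hcover).trans
    ((card_biUnion_le_card_mul _ _ ((k - t).choose (s - t)) fun T hT => ?_).trans_eq ?_)
  · rw [← (mem_powersetCard.1 hT).2]
    exact card_sparseVecs_superset_le T
  · rw [card_powersetCard, mem_sparseVecs.1 hz]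

lemma maxBall_pos {k s : ℕ} (hsk : s ≤ k) : 0 < maxBall k s := by
  have hne : (sparseVecs k s).Nonempty := by
    rw [← card_pos, card_sparseVecs]
    exact Nat.choose_pos hsk
  obtain ⟨z, hz⟩ := hne
  have hball : 0 < ((sparseVecs k s).filter fun w => hammingDist z w ≤ s / 2).card :=
    card_pos.2 ⟨z, mem_filter.2 ⟨hz, by simp⟩⟩
  exact hball.trans_le
    (le_sup (f := fun z => ((sparseVecs k s).filter fun w => hammingDist z w ≤ s / 2).card) hz)

lemma choose_mul_pow_le {k s t : ℕ} (hts : t ≤ s) (hsk : s ≤ k) :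
    s.choose t * k ^ t ≤ k.choose t * s ^ t := by
  induction t with
  | zero => simp
  | succ t ih =>
    have hfactor : (s - t) * k ≤ (k - t) * s := by
      rw [Nat.sub_mul, Nat.sub_mul, mul_comm k s]
      exact Nat.sub_le_sub_left (Nat.mul_le_mul_left t hsk) _
    refine Nat.le_of_mul_le_mul_right ?_ t.succ_pos
    calc s.choose (t + 1) * k ^ (t + 1) * (t + 1)
        = (s.choose (t + 1) * (t + 1)) * k ^ t * k := by ring
      _ = (s.choose t * k ^ t) * ((s - t) * k) := by rw [Nat.choose_succ_right_eq]; ring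
      _ ≤ (k.choose t * s ^ t) * ((k - t) * s) := Nat.mul_le_mul (ih (by omega)) hfactor
      _ = (k.choose (t + 1) * (t + 1)) * s ^ t * s := by rw [Nat.choose_succ_right_eq]; ring
      _ = k.choose (t + 1) * s ^ (t + 1) * (t + 1) := by ring

lemma maxBall_mul_pow_le {k s : ℕ} (hsk : s ≤ k) :
    maxBall k s * k ^ (s - s / 2 / 2) ≤ k.choose s * 2 ^ s * s ^ (s - s / 2 / 2) := by
  have hball := maxBall_le k s
  set t := s - s / 2 / 2
  have hts : t ≤ s := Nat.sub_le _ _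
  refine Nat.le_of_mul_le_mul_left ?_ (Nat.choose_pos hts)
  calc s.choose t * (maxBall k s * k ^ t)
      = maxBall k s * (s.choose t * k ^ t) := by ring
    _ ≤ (s.choose t * (k - t).choose (s - t)) * (k.choose t * s ^ t) :=
        Nat.mul_le_mul hball (choose_mul_pow_le hts hsk)
    _ = s.choose t * (k.choose t * (k - t).choose (s - t)) * s ^ t := by ring
    _ = s.choose t * (k.choose s * s.choose t) * s ^ t := by rw [Nat.choose_mul hts]
    _ ≤ s.choose t * (k.choose s * 2 ^ s) * s ^ t := by
        gcongr
        exact Nat.choose_le_two_pow s t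
    _ = s.choose t * (k.choose s * 2 ^ s * s ^ t) := by ring

/-- Lemma 4 (packing bound): for `1 ≤ s ≤ k/100` with `s` even,
`log |Z_{k,s}| − log N_{s/2}^max ≥ (s/8)·log(k/s)`. -/
theorem packing_bound (k s : ℕ) (hs : 1 ≤ s) (hse : Even s) (hsk : 100 * s ≤ k) :
    ((s : ℝ) / 8) * Real.log ((k : ℝ) / (s : ℝ)) ≤
      Real.log ((sparseVecs k s).card : ℝ) - Real.log (maxBall k s : ℝ) := by
  have hsk' : s ≤ k := by omega
  have hs0 : (0 : ℝ) < s := by exact_mod_cast hs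
  have hk0 : (0 : ℝ) < k := by exact_mod_cast hs.trans hsk'
  have hC : (0 : ℝ) < k.choose s := by exact_mod_cast Nat.choose_pos hsk'
  have hN : (0 : ℝ) < maxBall k s := by exact_mod_cast maxBall_pos hsk'
  have hbound := maxBall_mul_pow_le hsk'
  have ht : 3 * s ≤ 4 * (s - s / 2 / 2) := by omega
  rw [card_sparseVecs]
  set t := s - s / 2 / 2
  have hcast : (maxBall k s : ℝ) * (k : ℝ) ^ t ≤ (k.choose s : ℝ) * 2 ^ s * (s : ℝ) ^ t := by
    exact_mod_cast hbound
  have hlog := Real.log_le_log (by positivity) hcast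
  rw [Real.log_mul (by positivity) (by positivity), Real.log_mul (by positivity) (by positivity),
    Real.log_mul (by positivity) (by positivity), Real.log_pow, Real.log_pow, Real.log_pow] at hlog
  have hratio : 2 * Real.log 2 ≤ Real.log ((k : ℝ) / s) := by
    have hfour : (2 : ℝ) ^ 2 ≤ (k : ℝ) / s := by
      rw [le_div_iff₀ hs0]
      have : (100 : ℝ) * s ≤ k := by exact_mod_cast hsk
      linarith
    have := Real.log_le_log (by positivity) hfour
    rw [Real.log_pow] at this
    exact_mod_cast this
  have hdiv : Real.log ((k : ℝ) / s) = Real.log k - Real.log s :=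
    Real.log_div hk0.ne' hs0.ne'
  have ht' : (3 : ℝ) * s ≤ 4 * t := by exact_mod_cast ht
  have hlog2 : 0 < Real.log 2 := Real.log_pos one_lt_two
  nlinarith [mul_le_mul_of_nonneg_right ht' (by linarith : 0 ≤ Real.log ((k : ℝ) / s)),
    mul_le_mul_of_nonneg_left hratio hs0.le, hdiv]
end
end

section
/- (Hamming ball counting bound used in Lemma 4.) Let 1 ≤ s ≤ k with s even and let Z_{k,s} ⊆ {0,1}^k be the set of binary strings with exactly s ones. Then for every z ∈ Z_{k,s}, the number of z' ∈ Z_{k,s} with d_H(z, z') ≤ s/2 is at most (s choose s/2)·((k − s/2) choose s/2). -/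
open Real BigOperators Finset
open scoped Classical

noncomputable section

/-- If `B` meets `A` in at least `m` points, then `B` is the disjoint union of an `m`-subset of `A`
and a set of size `|B| - m`; hence there are at most `(|A| choose m) * ((k - m) choose (s - m))`
sets `B` of size `s` with this property. -/
theorem card_filter_le_card_inter {k : ℕ} (A : Finset (Fin k)) (s m : ℕ) :
    ((Finset.univ : Finset (Finset (Fin k))).filter
      fun B => B.card = s ∧ m ≤ (A ∩ B).card).card ≤
      A.card.choose m * (k - m).choose (s - m) := by
  have hsub : ((Finset.univ : Finset (Finset (Fin k))).filter
      fun B => B.card = s ∧ m ≤ (A ∩ B).card) ⊆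
      (A.powersetCard m).biUnion fun T => (Tᶜ.powersetCard (s - m)).image fun U => T ∪ U := by
    intro B hB
    obtain ⟨hBs, hm⟩ := (Finset.mem_filter.mp hB).2
    obtain ⟨T, hT, hTm⟩ := Finset.exists_subset_card_eq hm
    have hTA : T ⊆ A := hT.trans Finset.inter_subset_left
    have hTB : T ⊆ B := hT.trans Finset.inter_subset_right
    refine Finset.mem_biUnion.mpr ⟨T, Finset.mem_powersetCard.mpr ⟨hTA, hTm⟩,
      Finset.mem_image.mpr ⟨B \ T, Finset.mem_powersetCard.mpr ⟨?_, ?_⟩,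
        Finset.union_sdiff_of_subset hTB⟩⟩
    · intro x hx
      exact Finset.mem_compl.mpr (Finset.mem_sdiff.mp hx).2
    · rw [Finset.card_sdiff_of_subset hTB, hBs, hTm]
  refine (Finset.card_le_card hsub).trans ?_
  rw [← Finset.card_powersetCard]
  refine Finset.card_biUnion_le_card_mul _ _ _ fun T hT => Finset.card_image_le.trans ?_
  rw [Finset.card_powersetCard, Finset.card_compl, Fintype.card_fin,
    (Finset.mem_powersetCard.mp hT).2]

/-- The part of the support of `z` outside the support of `z'` has at most `d_H(z, z')` elements. -/
theorem card_support_le_card_inter_add_hammingDist {k : ℕ} (z z' : Fin k → Bool) :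
    (Finset.univ.filter fun x => z x = true).card ≤
      ((Finset.univ.filter fun x => z x = true) ∩
        (Finset.univ.filter fun x => z' x = true)).card + hammingDist z z' := by
  rw [← Finset.card_inter_add_card_sdiff (Finset.univ.filter fun x => z x = true)
    (Finset.univ.filter fun x => z' x = true), hammingDist]
  refine Nat.add_le_add_left (Finset.card_le_card fun x hx => ?_) _
  simp only [Finset.mem_sdiff, Finset.mem_filter, Finset.mem_univ, true_and] at hx ⊢
  exact fun h => hx.2 (h ▸ hx.1)

/-- Hamming ball counting bound used in Lemma 4: for `z ∈ Z_{k,s}` (with `s` even),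
the number of `z' ∈ Z_{k,s}` with `d_H(z,z') ≤ s/2` is at most
`(s choose s/2)·((k − s/2) choose s/2)`. -/
theorem hamming_ball_count (k s : ℕ) (hs : 1 ≤ s) (hse : Even s) (hsk : s ≤ k)
    (z : Fin k → Bool) (hz : z ∈ sparseVecs k s) :
    ((sparseVecs k s).filter fun z' => hammingDist z z' ≤ s / 2).card ≤
      s.choose (s / 2) * (k - s / 2).choose (s / 2) := by
  obtain ⟨m, rfl⟩ := hse
  have hzs : (Finset.univ.filter fun x => z x = true).card = m + m :=
    (Finset.mem_filter.mp hz).2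
  have hm : (m + m) / 2 = m := by omega
  have hcount := card_filter_le_card_inter (Finset.univ.filter fun x => z x = true) (m + m) m
  rw [hzs, Nat.add_sub_cancel] at hcount
  rw [hm]
  refine le_trans ?_ hcount
  refine Finset.card_le_card_of_injOn (fun z' => Finset.univ.filter fun x => z' x = true) ?_ ?_
  · intro z' hz'
    obtain ⟨hz's, hd⟩ := Finset.mem_filter.mp (Finset.mem_coe.mp hz')
    have hle := card_support_le_card_inter_add_hammingDist z z'
    rw [hzs] at hle
    have hinter : m ≤ ((Finset.univ.filter fun x => z x = true) ∩
        (Finset.univ.filter fun x => z' x = true)).card := by omega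
    exact Finset.mem_coe.mpr (Finset.mem_filter.mpr
      ⟨Finset.mem_univ _, (Finset.mem_filter.mp hz's).2, hinter⟩)
  · intro a _ b _ hab
    funext x
    have hx := Finset.ext_iff.mp hab x
    simp only [Finset.mem_filter, Finset.mem_univ, true_and] at hx
    exact Bool.eq_iff_iff.mpr hx
end
end

section
/- (Lemma 5, support identification under communication constraints.) There is a universal constant C₁ (one may take C₁ = 700000) such that the following holds. Let α ∈ (0,1), 1 ≤ s ≤ k/100, 1 ≤ ℓ ≤ log₂ s, and let p ∈ Δ_{k,s}. Suppose n ≥ C₁·s² log(k/s)/(α² min{2^ℓ, s}). Draw X_1,...,X_{n/2} i.i.d. from p, let h_1,...,h_{n/2} be independent uniformly random hash functions from [k] to [2^ℓ], set Y_i = h_i(X_i), and for x ∈ [k] let M(x) = #{i ≤ n/2 : h_i(x) = Y_i}. Let T ⊆ [k] be the set of the 2s symbols x with the largest values of M(x). Then with probability at least 0.95, p(T) = Σ_{x∈T} p(x) ≥ 1 − α/2. -/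
open Real BigOperators Finset
open scoped Classical

noncomputable section

/-- Joint pmf of the samples and the (fully uniform, independent) random hash functions:
`ω i = (X_i, h_i)` with `X_i ~ p` and `h_i` uniform among all functions `[k] → [2^ℓ]`. -/
def hashP {k l mh : ℕ} (p : Fin k → ℝ)
    (ω : Fin mh → Fin k × (Fin k → Fin (2 ^ l))) : ℝ :=
  ∏ i, p (ω i).1 * (((2 : ℝ) ^ l) ^ k)⁻¹

/-- `M(x)`: the number of users `i` with `h_i(x) = Y_i`, where `Y_i = h_i(X_i)`. -/
def Mcount {k l mh : ℕ} (ω : Fin mh → Fin k × (Fin k → Fin (2 ^ l))) (x : Fin k) : ℕ :=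
  (Finset.univ.filter fun i => (ω i).2 x = (ω i).2 (ω i).1).card

/-- The sum over all words of a product of letter weights is a power. -/
lemma sum_prod_letters {A : Type*} [Fintype A] {m : ℕ} (f : A → ℝ) :
    ∑ ω : Fin m → A, ∏ i, f (ω i) = (∑ a, f a) ^ m := by
  rw [Fintype.sum_pow]

/-- Two distinct coordinates of a function into `Fin B` collide for a
`1 / B` fraction of all functions. -/
lemma sum_indicator_collision {k B : ℕ} {x y : Fin k} (hxy : y ≠ x) :
    ∑ h : Fin k → Fin B, (if h x = h y then (1 : ℝ) else 0) = (B : ℝ) ^ (k - 1) := by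
  rw [← (Equiv.funSplitAt x (Fin B)).symm.sum_comp]
  rw [Fintype.sum_prod_type_right]
  have : ∀ r : {j // j ≠ x} → Fin B, ∑ v : Fin B,
      (if (Equiv.funSplitAt x (Fin B)).symm (v, r) x
        = (Equiv.funSplitAt x (Fin B)).symm (v, r) y then (1 : ℝ) else 0) = 1 := by
    intro r
    simp [Equiv.funSplitAt, Equiv.piSplitAt, hxy]
  simp only [this]
  simp

/-- The probability that a single user votes for the symbol `x`. -/
lemma sum_collision {k l : ℕ} {p : Fin k → ℝ} (hp : probVec p) (x : Fin k) :
    ∑ a : Fin k × (Fin k → Fin (2 ^ l)),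
      p a.1 * (((2 : ℝ) ^ l) ^ k)⁻¹ * (if a.2 x = a.2 a.1 then (1 : ℝ) else 0)
      = ((2 : ℝ) ^ l)⁻¹ + p x * (1 - ((2 : ℝ) ^ l)⁻¹) := by
  have hk : k ≠ 0 := by
    rintro rfl
    exact x.elim0
  set B : ℝ := (2 : ℝ) ^ l with hB
  have hB0 : B ≠ 0 := by positivity
  have hBk : B ^ k = B * B ^ (k - 1) := by
    rw [← pow_succ', Nat.sub_add_cancel (Nat.pos_of_ne_zero hk)]
  have inner : ∀ y : Fin k, ∑ h : Fin k → Fin (2 ^ l),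
      p y * (B ^ k)⁻¹ * (if h x = h y then (1 : ℝ) else 0)
      = p y * B⁻¹ + (if y = x then p y * (1 - B⁻¹) else 0) := by
    intro y
    rw [← Finset.mul_sum]
    by_cases hxy : y = x
    · subst hxy
      have : (B ^ k)⁻¹ * B ^ k = 1 := inv_mul_cancel₀ (by positivity)
      simp [← hB, mul_assoc, this]
      ring
    · rw [sum_indicator_collision hxy]
      push_cast
      rw [← hB, hBk]
      simp only [hxy, if_false, add_zero]
      field_simp
  rw [Fintype.sum_prod_type]
  simp only [inner, Finset.sum_add_distrib, ← Finset.sum_mul, hp.2]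
  simp

/-- Bound on the moment generating function of the vote count of `x`. -/
lemma mgf_Mcount_le {k l m : ℕ} {p : Fin k → ℝ} (hp : probVec p) (x : Fin k) (t : ℝ) :
    ∑ ω : Fin m → Fin k × (Fin k → Fin (2 ^ l)), hashP p ω * exp (t * Mcount ω x)
      ≤ exp (m * (((2 : ℝ) ^ l)⁻¹ + p x * (1 - ((2 : ℝ) ^ l)⁻¹)) * (exp t - 1)) := by
  set w : Fin k × (Fin k → Fin (2 ^ l)) → ℝ := fun a => p a.1 * (((2 : ℝ) ^ l) ^ k)⁻¹ with hw
  have hw0 : ∀ a, 0 ≤ w a := fun a => mul_nonneg (hp.1 _) (by positivity)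
  have hw1 : ∑ a, w a = 1 := by
    rw [Fintype.sum_prod_type]
    simp [hw, mul_left_comm, hp.2]
  have hprod : ∀ ω : Fin m → Fin k × (Fin k → Fin (2 ^ l)),
      hashP p ω * exp (t * Mcount ω x)
        = ∏ i, w (ω i) * (1 + (if (ω i).2 x = (ω i).2 (ω i).1 then (1 : ℝ) else 0)
            * (exp t - 1)) := by
    intro ω
    rw [Finset.prod_mul_distrib, hashP, Mcount, Finset.card_filter]
    congr 1
    push_cast
    rw [Finset.mul_sum, Real.exp_sum]
    refine Finset.prod_congr rfl fun i _ => ?_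
    split_ifs <;> simp
  simp only [hprod]
  rw [sum_prod_letters (fun a => w a * (1 + (if a.2 x = a.2 a.1 then (1 : ℝ) else 0)
            * (exp t - 1)))]
  have hsum : ∑ a : Fin k × (Fin k → Fin (2 ^ l)),
      w a * (1 + (if a.2 x = a.2 a.1 then (1 : ℝ) else 0) * (exp t - 1))
      = 1 + (((2 : ℝ) ^ l)⁻¹ + p x * (1 - ((2 : ℝ) ^ l)⁻¹)) * (exp t - 1) := by
    simp only [mul_add, mul_one, Finset.sum_add_distrib, hw1, ← mul_assoc, ← Finset.sum_mul]
    rw [sum_collision hp x]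
  have hnn : 0 ≤ ∑ a : Fin k × (Fin k → Fin (2 ^ l)),
      w a * (1 + (if a.2 x = a.2 a.1 then (1 : ℝ) else 0) * (exp t - 1)) := by
    refine Finset.sum_nonneg fun a _ => mul_nonneg (hw0 a) ?_
    split_ifs
    · simpa using (exp_pos t).le
    · simp
  calc _ ≤ (exp ((((2 : ℝ) ^ l)⁻¹ + p x * (1 - ((2 : ℝ) ^ l)⁻¹)) * (exp t - 1))) ^ m := by
        refine pow_le_pow_left₀ hnn ?_ m
        rw [hsum, add_comm]
        exact add_one_le_exp _
    _ = _ := by rw [← Real.exp_nat_mul, mul_assoc]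

lemma hashP_nonneg {k l m : ℕ} {p : Fin k → ℝ} (hp : probVec p)
    (ω : Fin m → Fin k × (Fin k → Fin (2 ^ l))) : 0 ≤ hashP p ω :=
  Finset.prod_nonneg fun _ _ => mul_nonneg (hp.1 _) (by positivity)

lemma sum_hashP {k l m : ℕ} {p : Fin k → ℝ} (hp : probVec p) :
    ∑ ω : Fin m → Fin k × (Fin k → Fin (2 ^ l)), hashP p ω = 1 := by
  simp only [hashP]
  rw [sum_prod_letters (fun a : Fin k × (Fin k → Fin (2 ^ l)) =>
    p a.1 * (((2 : ℝ) ^ l) ^ k)⁻¹), Fintype.sum_prod_type]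
  simp [mul_left_comm, hp.2]

/-- Chernoff bound for the event that a symbol outside the support gets many votes. -/
lemma upper_tail_Mcount {k l m : ℕ} {p : Fin k → ℝ} (hp : probVec p) {x : Fin k}
    (hx : p x = 0) {d : ℝ} (hd0 : 0 ≤ d) (hd : d ≤ 2 * ((2 : ℝ) ^ l)⁻¹) :
    ∑ ω : Fin m → Fin k × (Fin k → Fin (2 ^ l)),
        hashP p ω * (if m * (((2 : ℝ) ^ l)⁻¹ + d) ≤ Mcount ω x then 1 else 0)
      ≤ exp (-(m * d ^ 2 * 2 ^ l / 4)) := by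
  set B : ℝ := (2 : ℝ) ^ l with hB
  have hB0 : 0 < B := by positivity
  set t : ℝ := d * B / 2 with ht
  have ht0 : 0 ≤ t := by positivity
  have ht1 : t ≤ 1 := by
    have := mul_le_mul_of_nonneg_right hd hB0.le
    rw [mul_assoc, inv_mul_cancel₀ hB0.ne'] at this
    rw [ht]; linarith
  have hexp : exp t - 1 ≤ t + t ^ 2 := by
    have := Real.abs_exp_sub_one_sub_id_le (x := t) (by rwa [abs_of_nonneg ht0])
    linarith [le_abs_self (exp t - 1 - t)]
  calc _ ≤ ∑ ω : Fin m → Fin k × (Fin k → Fin (2 ^ l)),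
        exp (-(t * (m * (B⁻¹ + d)))) * (hashP p ω * exp (t * Mcount ω x)) := by
        refine Finset.sum_le_sum fun ω _ => ?_
        rw [mul_left_comm, ← Real.exp_add]
        refine mul_le_mul_of_nonneg_left ?_ (hashP_nonneg hp ω)
        split_ifs with h
        · apply Real.one_le_exp
          have := mul_le_mul_of_nonneg_left h ht0
          linarith
        · positivity
    _ ≤ exp (-(t * (m * (B⁻¹ + d)))) * exp (m * (B⁻¹ + p x * (1 - B⁻¹)) * (exp t - 1)) := by
        rw [← Finset.mul_sum]
        exact mul_le_mul_of_nonneg_left (mgf_Mcount_le hp x t) (exp_pos _).le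
    _ ≤ _ := by
        rw [← Real.exp_add, hx]
        apply Real.exp_le_exp.2
        have h1 : m * (B⁻¹ + 0 * (1 - B⁻¹)) * (exp t - 1) ≤ m * B⁻¹ * (t + t ^ 2) := by
          rw [zero_mul, add_zero]
          exact mul_le_mul_of_nonneg_left hexp (by positivity)
        refine (add_le_add_right h1 _).trans (le_of_eq ?_)
        rw [ht]
        field_simp
        ring

/-- Chernoff bound, in polynomial form, for the event that a heavy symbol gets few votes. -/
lemma lower_tail_Mcount {k l m : ℕ} {p : Fin k → ℝ} (hp : probVec p) {x : Fin k}
    (hm : 0 < m) (hl : 1 ≤ l) (hx : 0 < p x) {d : ℝ} (hd : d ≤ p x / 4) :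
    ∑ ω : Fin m → Fin k × (Fin k → Fin (2 ^ l)),
        hashP p ω * (if Mcount ω x < m * (((2 : ℝ) ^ l)⁻¹ + d) then 1 else 0)
      ≤ 32 * (((2 : ℝ) ^ l)⁻¹ + p x) / (m * p x ^ 2) := by
  set b : ℝ := ((2 : ℝ) ^ l)⁻¹ with hb
  have hb0 : 0 < b := by positivity
  have hb1 : b ≤ 1 / 2 := by
    rw [hb, one_div]
    refine inv_anti₀ (by norm_num) ?_
    simpa using pow_le_pow_right₀ (by norm_num : (1 : ℝ) ≤ 2) hl
  set q : ℝ := p x with hq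
  have hm' : (0 : ℝ) < m := by exact_mod_cast hm
  set t : ℝ := q / (4 * (b + q)) with ht
  have ht0 : 0 ≤ t := by positivity
  have htq : t * (b + q) = q / 4 := by rw [ht]; field_simp
  have hexp : exp (-t) - 1 ≤ -t + t ^ 2 / 2 := by
    have h1 := Real.quadratic_le_exp_of_nonneg ht0
    have h2 : exp (-t) * (1 + t + t ^ 2 / 2) ≤ 1 := by
      calc _ ≤ exp (-t) * exp t := mul_le_mul_of_nonneg_left h1 (exp_pos _).le
        _ = 1 := by rw [← Real.exp_add]; simp
    have h3 : 1 ≤ (1 - t + t ^ 2 / 2) * (1 + t + t ^ 2 / 2) := by nlinarith [sq_nonneg (t ^ 2)]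
    have h4 := le_of_mul_le_mul_right (h2.trans h3) (by positivity)
    linarith
  set y : ℝ := m * q ^ 2 / (32 * (b + q)) with hy
  have hy0 : 0 < y := by positivity
  have hty : m * (t * q) / 8 = y := by
    rw [hy, ht]; field_simp; norm_num
  calc _ ≤ ∑ ω : Fin m → Fin k × (Fin k → Fin (2 ^ l)),
        exp (t * (m * (b + d))) * (hashP p ω * exp (-t * Mcount ω x)) := by
        refine Finset.sum_le_sum fun ω _ => ?_
        rw [mul_left_comm, ← Real.exp_add]
        refine mul_le_mul_of_nonneg_left ?_ (hashP_nonneg hp ω)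
        split_ifs with h
        · apply Real.one_le_exp
          have := mul_le_mul_of_nonneg_left h.le ht0
          linarith
        · positivity
    _ ≤ exp (t * (m * (b + d))) * exp (m * (b + q * (1 - b)) * (exp (-t) - 1)) := by
        rw [← Finset.mul_sum]
        exact mul_le_mul_of_nonneg_left (mgf_Mcount_le hp x (-t)) (exp_pos _).le
    _ ≤ exp (-y) := by
        rw [← Real.exp_add]
        apply Real.exp_le_exp.2
        have hc0 : 0 ≤ b + q * (1 - b) := add_nonneg hb0.le (mul_nonneg hx.le (by linarith))
        have h1 := mul_le_mul_of_nonneg_left hexp hc0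
        have h2 : (b + q * (1 - b)) * (t ^ 2 / 2) ≤ (b + q) * (t ^ 2 / 2) :=
          mul_le_mul_of_nonneg_right (by nlinarith) (by positivity)
        have h3 : (b + q) * (t ^ 2 / 2) = t * q / 8 := by
          linear_combination (t / 2) * htq
        have h4 : t * d ≤ t * q / 4 := by
          linarith [mul_le_mul_of_nonneg_left hd ht0]
        have h5 : 0 ≤ t * q * (1 / 2 - b) := by
          have : 0 ≤ 1 / 2 - b := by linarith
          positivity
        have h6 : t * (b + d) + (b + q * (1 - b)) * (exp (-t) - 1) ≤ -(t * q / 8) := by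
          nlinarith
        have h7 := mul_le_mul_of_nonneg_left h6 hm'.le
        linarith
    _ ≤ y⁻¹ := by
        rw [Real.exp_neg]
        exact inv_anti₀ hy0 (by linarith [add_one_le_exp y])
    _ = _ := by rw [hy, inv_div]

/-- If fewer than `s` symbols outside the support reach the threshold `θ`, and the heavy symbols
below the threshold carry little mass, then the `2 s` top symbols carry almost all the mass. -/
lemma mass_top_ge {k s : ℕ} {p : Fin k → ℝ} (hp : probVec p) (hs : 1 ≤ s)
    (hsupp : suppSize p ≤ s) {M : Fin k → ℕ} {T : Finset (Fin k)} (hcard : T.card = 2 * s)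
    (htop : ∀ x ∈ T, ∀ x' ∉ T, M x' ≤ M x) {θ α : ℝ} (hα : 0 < α)
    (hN : ((univ.filter fun x => p x = 0 ∧ θ ≤ M x).card : ℝ) < s)
    (hQ : ∑ x ∈ univ.filter (fun x => α / (4 * s) ≤ p x),
      p x * (if (M x : ℝ) < θ then 1 else 0) ≤ α / 4) :
    1 - α / 2 ≤ ∑ x ∈ T, p x := by
  have hs0 : (0 : ℝ) < s := by exact_mod_cast hs
  obtain ⟨x₀, hx₀T, hx₀⟩ : ∃ x ∈ T, (M x : ℝ) < θ := by
    by_contra! hcon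
    have hsub : T ⊆ (univ.filter fun x => p x ≠ 0) ∪ univ.filter fun x => p x = 0 ∧ θ ≤ M x := by
      intro x hx
      by_cases h : p x = 0 <;> simp [h, hcon x hx]
    have h1 := (Finset.card_le_card hsub).trans (Finset.card_union_le _ _)
    have h2 : (univ.filter fun x => p x = 0 ∧ θ ≤ M x).card < s := by exact_mod_cast hN
    unfold suppSize at hsupp
    omega
  have hbelow : ∀ x ∉ T, (M x : ℝ) < θ := fun x hx =>
    lt_of_le_of_lt (by exact_mod_cast htop x₀ hx₀T x hx) hx₀
  have hcompl : ∑ x ∈ T, p x + ∑ x ∈ Tᶜ, p x = 1 := by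
    rw [Finset.sum_add_sum_compl, hp.2]
  have hpt : ∀ x ∈ Tᶜ, p x ≤ (if α / (4 * s) ≤ p x then
      p x * (if (M x : ℝ) < θ then 1 else 0) else 0) + if p x ≠ 0 then α / (4 * s) else 0 := by
    intro x hx
    have hxθ := hbelow x (Finset.mem_compl.1 hx)
    have hpos : 0 ≤ α / (4 * s) := by positivity
    by_cases h : α / (4 * s) ≤ p x
    · simp only [h, hxθ, if_true, mul_one]
      split_ifs <;> linarith
    · by_cases h0 : p x = 0
      · simp [h0]
      · simp only [h, if_false, zero_add, ne_eq, h0, not_false_eq_true, if_true]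
        linarith
  have hlight : ∑ x, (if p x ≠ 0 then α / (4 * s) else 0) ≤ α / 4 := by
    rw [← Finset.sum_filter, Finset.sum_const, nsmul_eq_mul]
    have : ((univ.filter fun x => p x ≠ 0).card : ℝ) ≤ s := by exact_mod_cast hsupp
    calc _ ≤ (s : ℝ) * (α / (4 * s)) := mul_le_mul_of_nonneg_right this (by positivity)
      _ = α / 4 := by field_simp
  have hmiss : ∑ x ∈ Tᶜ, p x ≤ α / 4 + α / 4 := by
    refine (Finset.sum_le_sum hpt).trans ?_
    refine (Finset.sum_le_sum_of_subset_of_nonneg (Finset.subset_univ _) ?_).trans ?_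
    · intro x _ _
      have := hp.1 x
      positivity
    · rw [Finset.sum_add_distrib, ← Finset.sum_filter]
      exact add_le_add hQ hlight
  linarith

/-- Lemma 5 (support identification under communication constraints): there is a universal
constant `C₁` such that if `n ≥ C₁ s² log(k/s)/(α² min{2^ℓ,s})` and `T ω` is a set of the
`2s` symbols with the largest values of `M(·)(ω)` (computed from the first `n/2 = mh`
samples and hashes), then with probability at least `0.95`, `p(T) ≥ 1 − α/2`. -/
theorem lemma5_support_identification :
    ∃ C₁ : ℝ, 0 < C₁ ∧
      ∀ (k s l n mh : ℕ) (α : ℝ) (p : Fin k → ℝ)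
        (T : (Fin mh → Fin k × (Fin k → Fin (2 ^ l))) → Finset (Fin k)),
        0 < α → α < 1 → 1 ≤ s → 100 * s ≤ k → 1 ≤ l → 2 ^ l ≤ s →
        n = 2 * mh → probVec p → suppSize p ≤ s →
        C₁ * (s : ℝ) ^ 2 * Real.log ((k : ℝ) / (s : ℝ)) /
            (α ^ 2 * min ((2 : ℝ) ^ l) (s : ℝ)) ≤ (n : ℝ) →
        (∀ ω, (T ω).card = 2 * s ∧
          ∀ x ∈ T ω, ∀ x' ∉ T ω, Mcount ω x' ≤ Mcount ω x) →
        (19 : ℝ) / 20 ≤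
          ∑ ω : Fin mh → Fin k × (Fin k → Fin (2 ^ l)),
            hashP p ω * (if 1 - α / 2 ≤ ∑ x ∈ T ω, p x then 1 else 0) := by
  refine ⟨700000, by norm_num, ?_⟩
  intro k s l n m α p T hα0 hα1 hs hsk hl hls hnm hp hsupp hn hT
  set B : ℝ := (2 : ℝ) ^ l with hB
  have hB0 : 0 < B := by positivity
  have hBs : B ≤ s := by
    rw [hB]
    exact_mod_cast hls
  have hs0 : (0 : ℝ) < s := by exact_mod_cast hs
  have hks : 100 * (s : ℝ) ≤ k := by exact_mod_cast hsk
  have hk0 : (0 : ℝ) < k := by linarith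
  set L : ℝ := Real.log ((k : ℝ) / s) with hL
  have hL1 : 1 ≤ L := by
    rw [hL, Real.le_log_iff_exp_le (by positivity), le_div_iff₀ hs0]
    nlinarith [Real.exp_one_lt_d9]
  have hkey : 700000 * (s : ℝ) ^ 2 * L ≤ 2 * m * (α ^ 2 * B) := by
    rw [min_eq_left hBs, div_le_iff₀ (by positivity), hnm] at hn
    push_cast at hn
    exact hn
  have hkey' : 350000 * (s : ℝ) ^ 2 ≤ m * (α ^ 2 * B) := by
    have : (s : ℝ) ^ 2 * 1 ≤ (s : ℝ) ^ 2 * L := mul_le_mul_of_nonneg_left hL1 (by positivity)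
    linarith
  have hm : 0 < m := by
    rcases Nat.eq_zero_or_pos m with h | h
    · rw [h] at hkey'
      have : 0 < (s : ℝ) ^ 2 := by positivity
      norm_num at hkey'
      linarith
    · exact h
  have hm0 : (0 : ℝ) < m := by exact_mod_cast hm
  set d : ℝ := α / (16 * s) with hd
  have hdB : d ≤ 2 * B⁻¹ := by
    rw [hd, ← div_eq_mul_inv, div_le_div_iff₀ (by positivity) hB0]
    nlinarith
  set θ : ℝ := m * (B⁻¹ + d) with hθ
  have hupper : ∀ x, p x = 0 →
      ∑ ω : Fin m → Fin k × (Fin k → Fin (2 ^ l)),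
        hashP p ω * (if θ ≤ Mcount ω x then 1 else 0) ≤ ((s : ℝ) / k) ^ 2 := by
    intro x hx
    refine (upper_tail_Mcount hp hx (by positivity) hdB).trans ?_
    have hexp : exp (-(2 * L)) = ((s : ℝ) / k) ^ 2 := by
      rw [Real.exp_neg, two_mul, Real.exp_add, hL, Real.exp_log (by positivity), ← sq, ← inv_pow,
        inv_div]
    rw [← hexp]
    apply Real.exp_le_exp.2
    have : m * d ^ 2 * B / 4 = m * (α ^ 2 * B) / (1024 * s ^ 2) := by
      rw [hd]
      field_simp
      norm_num
    rw [← hB, this, neg_le_neg_iff, le_div_iff₀ (by positivity)]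
    have : 0 ≤ (s : ℝ) ^ 2 * L := by positivity
    linarith
  have hlower : ∀ x, α / (4 * s) ≤ p x →
      p x * ∑ ω : Fin m → Fin k × (Fin k → Fin (2 ^ l)),
        hashP p ω * (if Mcount ω x < θ then 1 else 0) ≤ α / (1000 * s) := by
    intro x hx
    have hx0 : 0 < p x := lt_of_lt_of_le (by positivity) hx
    have hdx : d ≤ p x / 4 := by
      have : d = α / (4 * s) / 4 := by
        rw [hd]
        field_simp
        norm_num
      linarith
    refine (mul_le_mul_of_nonneg_left
      (lower_tail_Mcount hp hm hl hx0 hdx) hx0.le).trans ?_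
    rw [← hB]
    have hsplit : p x * (32 * (B⁻¹ + p x) / (m * p x ^ 2)) = 32 / (m * B * p x) + 32 / m := by
      field_simp
    have hfirst : 32 / (m * B * p x) ≤ α / (2000 * s) := by
      rw [div_le_div_iff₀ (by positivity) (by positivity)]
      rw [div_le_iff₀ (by positivity)] at hx
      have h1 : m * B * α * α ≤ m * B * α * (p x * (4 * s)) :=
        mul_le_mul_of_nonneg_left hx (by positivity)
      have h2 : (350000 * s) * (s : ℝ) ≤ (4 * (α * (m * B * p x))) * s := by linarith
      have := le_of_mul_le_mul_right h2 hs0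
      linarith
    have hsecond : 32 / (m : ℝ) ≤ α / (2000 * s) := by
      rw [div_le_div_iff₀ hm0 (by positivity)]
      have h1 : α * (m * α * B) ≤ 1 * (m * α * s) :=
        mul_le_mul hα1.le (mul_le_mul_of_nonneg_left hBs (by positivity)) (by positivity)
          zero_le_one
      have h2 : (350000 * s) * (s : ℝ) ≤ (α * m) * s := by linarith
      have := le_of_mul_le_mul_right h2 hs0
      linarith
    have hsum : α / (2000 * s) + α / (2000 * s) = α / (1000 * s) := by
      field_simp
      norm_num
    linarith
  set Z := univ.filter fun x => p x = 0 with hZ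
  set H := univ.filter fun x => α / (4 * s) ≤ p x with hH
  have hHcard : (H.card : ℝ) ≤ s := by
    have : H ⊆ univ.filter fun x => p x ≠ 0 := by
      intro x hx
      have hx' := (Finset.mem_filter.1 hx).2
      have : 0 < p x := lt_of_lt_of_le (by positivity) hx'
      simp [this.ne']
    exact_mod_cast (Finset.card_le_card this).trans hsupp
  have hZcard : (Z.card : ℝ) ≤ k := by
    exact_mod_cast (Finset.card_le_univ Z).trans (by simp)
  have hfail : ∀ ω : Fin m → Fin k × (Fin k → Fin (2 ^ l)),
      1 - (if 1 - α / 2 ≤ ∑ x ∈ T ω, p x then (1 : ℝ) else 0)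
        ≤ (s : ℝ)⁻¹ * ∑ x ∈ Z, (if θ ≤ Mcount ω x then (1 : ℝ) else 0)
          + 4 / α * ∑ x ∈ H, p x * (if (Mcount ω x : ℝ) < θ then 1 else 0) := by
    intro ω
    have hN0 : 0 ≤ ∑ x ∈ Z, (if θ ≤ Mcount ω x then (1 : ℝ) else 0) :=
      Finset.sum_nonneg fun x _ => by positivity
    have hQ0 : 0 ≤ ∑ x ∈ H, p x * (if (Mcount ω x : ℝ) < θ then 1 else 0) :=
      Finset.sum_nonneg fun x _ => mul_nonneg (hp.1 x) (by positivity)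
    split_ifs with hgood
    · rw [sub_self]
      positivity
    · rw [sub_zero]
      by_contra! hlt
      have hN0' := mul_nonneg (inv_nonneg.2 hs0.le) hN0
      have hQ0' := mul_nonneg (by positivity : 0 ≤ 4 / α) hQ0
      refine hgood (mass_top_ge (θ := θ) hp hs hsupp (hT ω).1 (hT ω).2 hα0 ?_ ?_)
      · have h1 : (s : ℝ)⁻¹ * ∑ x ∈ Z, (if θ ≤ Mcount ω x then (1 : ℝ) else 0) < 1 := by
          linarith
        rw [inv_mul_lt_iff₀ hs0, mul_one, Finset.sum_boole, hZ, Finset.filter_filter] at h1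
        exact h1
      · have h1 : 4 / α * ∑ x ∈ H, p x * (if (Mcount ω x : ℝ) < θ then 1 else 0) ≤ 1 := by
          linarith
        rw [div_mul_eq_mul_div, div_le_one hα0] at h1
        linarith
  have hNexp : ∑ ω : Fin m → Fin k × (Fin k → Fin (2 ^ l)), hashP p ω *
      ((s : ℝ)⁻¹ * ∑ x ∈ Z, (if θ ≤ Mcount ω x then (1 : ℝ) else 0)) ≤ 1 / 100 := by
    simp only [mul_left_comm _ (s : ℝ)⁻¹, ← Finset.mul_sum]
    simp only [Finset.mul_sum (s := Z)]
    rw [Finset.sum_comm]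
    have h1 := Finset.sum_le_card_nsmul Z _ _ fun x hx => hupper x (Finset.mem_filter.1 hx).2
    rw [nsmul_eq_mul] at h1
    have h2 : (Z.card : ℝ) * ((s : ℝ) / k) ^ 2 ≤ k * ((s : ℝ) / k) ^ 2 :=
      mul_le_mul_of_nonneg_right hZcard (by positivity)
    have h3 : k * ((s : ℝ) / k) ^ 2 ≤ s * (1 / 100) := by
      have : k * ((s : ℝ) / k) ^ 2 = s * s / k := by field_simp
      rw [this, div_le_iff₀ hk0]
      nlinarith
    rw [inv_mul_le_iff₀ hs0]
    linarith
  have hQexp : ∑ ω : Fin m → Fin k × (Fin k → Fin (2 ^ l)), hashP p ω *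
      (4 / α * ∑ x ∈ H, p x * (if (Mcount ω x : ℝ) < θ then 1 else 0)) ≤ 1 / 250 := by
    simp only [mul_left_comm _ (4 / α), ← Finset.mul_sum]
    simp only [Finset.mul_sum (s := H)]
    rw [Finset.sum_comm]
    simp only [mul_left_comm _ (p _), ← Finset.mul_sum]
    have h1 := Finset.sum_le_card_nsmul H _ _ fun x hx => hlower x (Finset.mem_filter.1 hx).2
    rw [nsmul_eq_mul] at h1
    have h2 : (H.card : ℝ) * (α / (1000 * s)) ≤ s * (α / (1000 * s)) :=
      mul_le_mul_of_nonneg_right hHcard (by positivity)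
    have h3 : s * (α / (1000 * s)) = α / 1000 := by field_simp
    rw [div_mul_eq_mul_div, div_le_iff₀ hα0]
    linarith
  have htotal := Finset.sum_le_sum fun ω (_ : ω ∈ univ) =>
    mul_le_mul_of_nonneg_left (hfail ω) (hashP_nonneg hp ω)
  simp only [mul_sub, mul_add, mul_one, Finset.sum_sub_distrib, Finset.sum_add_distrib,
    sum_hashP hp] at htotal
  linarith
end
end
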